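/- Let D be a countable rooted digraph with root r. Then there exists a D-vertex-large spanning subdigraph E of D which is a vertex-flame. -/

import Mathlib

namespace FlamePaper

universe u
variable {V : Type u}

/-- A (nonempty, repetition-free) directed path, given by the list of its vertices;
its edge set consists of the pairs of consecutive vertices. A one-vertex list is the
trivial `v→v` path. -/
structure DiPath (V : Type u) where
  verts : List V
  ne : verts ≠ []
  nodup : verts.Nodup

namespace DiPath
variable (P : DiPath V)
def first : V := P.verts.head P.ne
def last : V := P.verts.getLast P.ne
def vertexSet : Set V := {x | x ∈ P.verts}
def edges : Set (V × V) := {e | e ∈ P.verts.zip P.verts.tail}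
def internal : Set V := P.vertexSet \ {P.first, P.last}
/-- The last edge of `P` (as a set; empty for the trivial path). -/
def lastEdge : Set (V × V) := {e ∈ P.edges | e.2 = P.last}
end DiPath

/-- `P` is a path of the digraph `D`. -/
def IsPathIn (D : Set (V × V)) (P : DiPath V) : Prop := P.edges ⊆ D

/-- `P` is an `a→b` path in `D`. -/
def IsPath (D : Set (V × V)) (a b : V) (P : DiPath V) : Prop :=
  IsPathIn D P ∧ P.first = a ∧ P.last = b

/-- The set of ingoing edges of `v` in `D`. -/
def inEdges (D : Set (V × V)) (v : V) : Set (V × V) := {e ∈ D | e.2 = v}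

/-- The set of outgoing edges of `v` in `D`. -/
def outEdges (D : Set (V × V)) (v : V) : Set (V × V) := {e ∈ D | e.1 = v}

/-- A rooted digraph: the root has no ingoing edges. -/
def IsRooted (D : Set (V × V)) (r : V) : Prop := inEdges D r = ∅

/-- `Ps` is a system of internally disjoint `r→v` paths in `D`: any two distinct
members share exactly the vertices `r` and `v`. -/
def IntDisjSystem (D : Set (V × V)) (r v : V) (Ps : Set (DiPath V)) : Prop :=
  (∀ P ∈ Ps, IsPath D r v P) ∧
  ∀ P ∈ Ps, ∀ Q ∈ Ps, P ≠ Q → P.vertexSet ∩ Q.vertexSet = {r, v}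

/-- `A_last(Ps)`: the set of last edges of the paths in `Ps`. -/
def lastEdges (Ps : Set (DiPath V)) : Set (V × V) := ⋃ P ∈ Ps, P.lastEdge

/-- `𝒢_D(v)`: the set of those `I ⊆ in_D(v)` which arise as the set of last edges
of a system of internally disjoint `r→v` paths of `D`. -/
def GSet (D : Set (V × V)) (r v : V) : Set (Set (V × V)) :=
  {I | ∃ Ps, IntDisjSystem D r v Ps ∧ lastEdges Ps = I}

/-- `Ps ∈ ℑ_D(v)`: an internally disjoint system of `r→v` paths of `D` from each member
of which one can choose either an internal vertex or an edge so that the resulting set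
meets every `r→v` path of `D`. -/
def EMSystem (D : Set (V × V)) (r v : V) (Ps : Set (DiPath V)) : Prop :=
  IntDisjSystem D r v Ps ∧
  ∃ sel : DiPath V → V ⊕ (V × V),
    (∀ P ∈ Ps, (∀ x, sel P = Sum.inl x → x ∈ P.internal) ∧
              (∀ e, sel P = Sum.inr e → e ∈ P.edges)) ∧
    ∀ Q : DiPath V, IsPath D r v Q →
      ∃ P ∈ Ps, (∀ x, sel P = Sum.inl x → x ∈ Q.vertexSet) ∧
               (∀ e, sel P = Sum.inr e → e ∈ Q.edges)

/-- The path-system `Ps` lies in `L`. -/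
def LiesIn (Ps : Set (DiPath V)) (L : Set (V × V)) : Prop := ∀ P ∈ Ps, IsPathIn L P

/-- `L` is a `D`-vertex-large spanning subdigraph of `D`. -/
def IsLarge (D L : Set (V × V)) (r : V) : Prop :=
  L ⊆ D ∧ ∀ v, v ≠ r → ∃ Ps, EMSystem D r v Ps ∧ LiesIn Ps L

/-- `F` is a vertex-flame with root `r`. -/
def IsFlame (F : Set (V × V)) (r : V) : Prop :=
  ∀ v, v ≠ r → inEdges F v ∈ GSet F r v

/-- `F` is a quasi-vertex-flame with root `r`. -/
def IsQuasiFlame (F : Set (V × V)) (r : V) : Prop :=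
  ∀ v, v ≠ r → ∀ I ⊆ inEdges F v, I.Finite → I ∈ GSet F r v

/-- `S` separates `b` from `a` in `D`: every `a→b` path of `D` meets `S`. -/
def Separates (D : Set (V × V)) (a b : V) (S : Set V) : Prop :=
  ∀ P : DiPath V, IsPath D a b P → (P.vertexSet ∩ S).Nonempty

/-- `𝔖_D(v)`: the Erdős–Menger separations corresponding to `v`. -/
def SepSet (D : Set (V × V)) (r v : V) : Set (Set V) :=
  {S | r ∉ S ∧ v ∉ S ∧ Separates (D \ {(r, v)}) r v S ∧
    ∃ Ps, IntDisjSystem D r v Ps ∧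
      ∃ sel : DiPath V → V, (∀ P ∈ Ps, sel P ∈ P.internal) ∧ S = sel '' Ps}

/-- The entrance of `X` with respect to `D`. -/
def entrance (D : Set (V × V)) (X : Set V) : Set V :=
  {v ∈ X | ∃ u, u ∉ X ∧ (u, v) ∈ D}

/-- `int_D(X) = X ∖ ent_D(X)`. -/
def interiorSet (D : Set (V × V)) (X : Set V) : Set V := X \ entrance D X

/-- `B` is a `v`-bubble of `D` (with root `r`): `B ⊆ V − r` and there is a `v`-infan
`{P_u : u ∈ ent_D(B)}` in `D ∩ (B × B)` where `P_u` starts at `u`. -/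
def IsBubble (D : Set (V × V)) (r v : V) (B : Set V) : Prop :=
  r ∉ B ∧
  ∃ F : V → DiPath V,
    (∀ u ∈ entrance D B, IsPath (D ∩ B ×ˢ B) u v (F u)) ∧
    ∀ u ∈ entrance D B, ∀ u' ∈ entrance D B, u ≠ u' →
      (F u).vertexSet ∩ (F u').vertexSet = {v}

/-- `bubb_D(v)`. -/
def bubbles (D : Set (V × V)) (r v : V) : Set (Set V) := {B | IsBubble D r v B}

/-- `B_{v,D}`: the union of all `v`-bubbles of `D`. -/
def maxBubble (D : Set (V × V)) (r v : V) : Set V := ⋃₀ bubbles D r v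

/-- `B_{S,v,D}`: the set of vertices `u` such that every `r→u` path of `D−rv` meets `S`. -/
def Bset (D : Set (V × V)) (r v : V) (S : Set V) : Set V :=
  {u | ∀ P : DiPath V, IsPath (D \ {(r, v)}) r u P → (P.vertexSet ∩ S).Nonempty}

/-- `Ps` is an `r`-fan in `D`: paths of `D` starting at `r`, any two distinct members
having only the vertex `r` in common. -/
def IsRFan (D : Set (V × V)) (r : V) (Ps : Set (DiPath V)) : Prop :=
  (∀ P ∈ Ps, IsPathIn D P ∧ P.first = r) ∧
  ∀ P ∈ Ps, ∀ Q ∈ Ps, P ≠ Q → P.vertexSet ∩ Q.vertexSet = {r}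

/-- The set of first vertices of the paths in `Ps`. -/
def Vfirst (Ps : Set (DiPath V)) : Set V := DiPath.first '' Ps

/-- The set of last vertices of the paths in `Ps`. -/
def Vlast (Ps : Set (DiPath V)) : Set V := DiPath.last '' Ps

/-- `P` is an `X→Y` path in `D`: exactly its first vertex lies in `X` and
exactly its last vertex lies in `Y`. -/
def IsXYPath (D : Set (V × V)) (X Y : Set V) (P : DiPath V) : Prop :=
  IsPathIn D P ∧ P.vertexSet ∩ X = {P.first} ∧ P.vertexSet ∩ Y = {P.last}

/-- `Ps` is a system of pairwise (vertex-)disjoint `X→Y` paths of `D`. -/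
def DisjXYSystem (D : Set (V × V)) (X Y : Set V) (Ps : Set (DiPath V)) : Prop :=
  (∀ P ∈ Ps, IsXYPath D X Y P) ∧
  ∀ P ∈ Ps, ∀ Q ∈ Ps, P ≠ Q → P.vertexSet ∩ Q.vertexSet = ∅

/-- `κ_D(r,v)`: the maximum size of a (finite) system of internally disjoint `r→v`
paths of `D`. -/
noncomputable def kappa (D : Set (V × V)) (r v : V) : ℕ :=
  sSup {n : ℕ | ∃ Ps : Set (DiPath V), IntDisjSystem D r v Ps ∧ Ps.Finite ∧ Ps.ncard = n}
section Linkages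
open Relation

theorem eq_of_reflTransGen_of_no_out {M : V → V → Prop} {x y : V} (h : ReflTransGen M x y)
    (hx : ∀ z, ¬ M x z) : y = x := by
  rcases h.cases_head with h | ⟨z, hz, -⟩
  · exact h.symm
  · exact absurd hz (hx z)

theorem eq_of_reflTransGen_of_no_in {M : V → V → Prop} {x y : V} (h : ReflTransGen M x y)
    (hy : ∀ z, ¬ M z y) : x = y := by
  rcases h.cases_tail with h | ⟨z, -, hz⟩
  · exact h.symm
  · exact absurd hz (hy z)

theorem reflTransGen_swap_iff {M : V → V → Prop} {x y : V} :
    ReflTransGen (Function.swap M) x y ↔ ReflTransGen M y x := reflTransGen_swap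

/-- `M` is a set of edges of `G` forming pairwise disjoint paths which end in `X`, such that
every vertex of `X` is reached from `A`. -/
structure IsCov (G : V → V → Prop) (A X : Set V) (M : V → V → Prop) : Prop where
  sub : ∀ ⦃x y⦄, M x y → G x y
  lu : ∀ ⦃x y z⦄, M x z → M y z → x = y
  ru : ∀ ⦃x y z⦄, M x y → M x z → y = z
  out : ∀ ⦃x y⦄, x ∈ X → ¬ M x y
  reach : ∀ ⦃x⦄, x ∈ X → ∃ a ∈ A, ReflTransGen M a x

/-- `X` is the set of terminal vertices of some disjoint paths of `G` starting in `A`. -/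
def Cov (G : V → V → Prop) (A X : Set V) : Prop := ∃ M, IsCov G A X M

/-- `M` is the edge set of a system of disjoint paths of `G` which start exactly in the
vertices of `A` and end exactly in the vertices of `X`. -/
structure IsLink (G : V → V → Prop) (A X : Set V) (M : V → V → Prop) : Prop
    extends IsCov G A X M where
  noin : ∀ ⦃a y⦄, a ∈ A → ¬ M y a
  fwd : ∀ ⦃a⦄, a ∈ A → ∃ x ∈ X, ReflTransGen M a x
  src : ∀ ⦃x y⦄, M x y → ∃ a ∈ A, ReflTransGen M a x
  tgt : ∀ ⦃x y⦄, M x y → ∃ z ∈ X, ReflTransGen M y z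

theorem IsCov.mono {G G' M : V → V → Prop} {A A' X X' : Set V} (h : IsCov G A X M)
    (hG : ∀ ⦃x y⦄, M x y → G x y → G' x y) (hA : A ⊆ A') (hX : X' ⊆ X) : IsCov G' A' X' M where
  sub _ _ hxy := hG hxy (h.sub hxy)
  lu := h.lu
  ru := h.ru
  out _ _ hx := h.out (hX hx)
  reach _ hx := let ⟨a, ha, h'⟩ := h.reach (hX hx); ⟨a, hA ha, h'⟩

theorem Cov.mono {G G' : V → V → Prop} {A A' X X' : Set V} (h : Cov G A X)
    (hG : ∀ ⦃x y⦄, G x y → G' x y) (hA : A ⊆ A') (hX : X' ⊆ X) : Cov G' A' X' :=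
  let ⟨M, hM⟩ := h; ⟨M, hM.mono (fun _ _ _ h => hG h) hA hX⟩

theorem IsLink.mono {G G' M : V → V → Prop} {A X : Set V} (h : IsLink G A X M)
    (hG : ∀ ⦃x y⦄, M x y → G x y → G' x y) : IsLink G' A X M :=
  { h with toIsCov := h.toIsCov.mono hG subset_rfl subset_rfl }

theorem IsLink.swap {G M : V → V → Prop} {A X : Set V} (h : IsLink G A X M) :
    IsLink (Function.swap G) X A (Function.swap M) where
  sub _ _ hxy := h.sub hxy
  lu _ _ _ h1 h2 := h.ru h1 h2
  ru _ _ _ h1 h2 := h.lu h1 h2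
  out _ _ hx := h.noin hx
  reach _ hx := by simpa only [reflTransGen_swap_iff] using h.fwd hx
  noin _ _ hx := h.out hx
  fwd _ hx := by simpa only [reflTransGen_swap_iff] using h.reach hx
  src _ _ hxy := by simpa only [reflTransGen_swap_iff] using h.tgt hxy
  tgt _ _ hxy := by simpa only [reflTransGen_swap_iff] using h.src hxy

theorem IsCov.total {G M : V → V → Prop} {A X : Set V} (h : IsCov G A X M) {x y z : V}
    (h1 : ReflTransGen M x y) (h2 : ReflTransGen M x z) :
    ReflTransGen M y z ∨ ReflTransGen M z y :=
  ReflTransGen.total_of_right_unique (fun _ _ _ h1 h2 => h.ru h1 h2) h1 h2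

theorem IsCov.total_left {G M : V → V → Prop} {A X : Set V} (h : IsCov G A X M) {x y z : V}
    (h1 : ReflTransGen M y x) (h2 : ReflTransGen M z x) :
    ReflTransGen M y z ∨ ReflTransGen M z y := by
  have := ReflTransGen.total_of_right_unique (r := Function.swap M)
    (fun _ _ _ h1 h2 => h.lu h1 h2) (reflTransGen_swap_iff.2 h1) (reflTransGen_swap_iff.2 h2)
  simp only [reflTransGen_swap_iff] at this
  exact this.symm

theorem IsCov.target_unique {G M : V → V → Prop} {A X : Set V} (h : IsCov G A X M) {a x y : V}
    (hx : x ∈ X) (hy : y ∈ X) (h1 : ReflTransGen M a x) (h2 : ReflTransGen M a y) : x = y := by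
  rcases h.total h1 h2 with h' | h'
  · exact (eq_of_reflTransGen_of_no_out h' fun _ => h.out hx).symm
  · exact eq_of_reflTransGen_of_no_out h' fun _ => h.out hy

theorem IsCov.before_target {G M : V → V → Prop} {A X : Set V} (h : IsCov G A X M) {a w x : V}
    (hx : x ∈ X) (h1 : ReflTransGen M a x) (h2 : ReflTransGen M a w) : ReflTransGen M w x := by
  rcases h.total h1 h2 with h' | h'
  · rw [eq_of_reflTransGen_of_no_out h' fun _ => h.out hx]
  · exact h'

theorem IsLink.source_unique {G M : V → V → Prop} {A X : Set V} (h : IsLink G A X M) {a b x : V}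
    (ha : a ∈ A) (hb : b ∈ A) (h1 : ReflTransGen M a x) (h2 : ReflTransGen M b x) : a = b := by
  rcases h.total_left h1 h2 with h' | h'
  · exact eq_of_reflTransGen_of_no_in h' fun _ => h.noin hb
  · exact (eq_of_reflTransGen_of_no_in h' fun _ => h.noin ha).symm

theorem IsCov.exists_last {G M : V → V → Prop} {A X : Set V} (h : IsCov G A X M) {x : V}
    (hx : x ∈ X) : ∃ a ∈ A, ReflTransGen M a x ∧ ∀ w ∈ A, ∀ d, M a d → ¬ ReflTransGen M d w := by
  obtain ⟨a₀, ha₀, h₀⟩ := h.reach hx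
  have key : ∀ c, ReflTransGen M c x → (∃ w ∈ A, ReflTransGen M c w) →
      ∃ a ∈ A, ReflTransGen M a x ∧ ∀ w ∈ A, ∀ d, M a d → ¬ ReflTransGen M d w := by
    intro c hc
    induction hc using ReflTransGen.head_induction_on with
    | refl =>
      rintro ⟨w, hw, hxw⟩
      rw [eq_of_reflTransGen_of_no_out hxw fun _ => h.out hx] at hw
      exact ⟨x, hw, .refl, fun _ _ d hd => absurd hd (h.out hx)⟩
    | head hcd hdx ih =>
      rename_i c d
      rintro ⟨w, hw, hcw⟩
      by_cases hd : ∃ w ∈ A, ReflTransGen M d w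
      · exact ih hd
      · push Not at hd
        rcases hcw.cases_head with rfl | ⟨e, he, hew⟩
        · refine ⟨c, hw, .head hcd hdx, fun w hw e he hew => hd w hw ?_⟩
          rwa [h.ru hcd he]
        · exact absurd (h.ru hcd he ▸ hew) (hd w hw)
  exact key a₀ h₀ ⟨a₀, ha₀, .refl⟩

theorem IsCov.exists_isLink {G M : V → V → Prop} {A X : Set V} (h : IsCov G A X M) :
    ∃ A' ⊆ A, ∃ M' : V → V → Prop, (∀ x y, M' x y → M x y) ∧ IsLink G A' X M' ∧
      ((∀ a ∈ A, (∀ y, ¬ M y a) ∧ ∃ x ∈ X, ReflTransGen M a x) → A' = A) := by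
  set A' : Set V := {a | a ∈ A ∧ (∃ x ∈ X, ReflTransGen M a x) ∧
    ∀ w ∈ A, ∀ d, M a d → ¬ ReflTransGen M d w} with hA'
  set M' : V → V → Prop := fun u w => M u w ∧ (∃ x ∈ X, ReflTransGen M w x) ∧
    ∃ a ∈ A', ReflTransGen M a u with hM'
  have lift : ∀ {a u w : V}, a ∈ A' → ReflTransGen M a u → ReflTransGen M u w →
      (∃ x ∈ X, ReflTransGen M w x) → ReflTransGen M' u w := by
    intro a u w ha hau huw
    induction huw with
    | refl => exact fun _ => .refl
    | tail h1 h2 ih =>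
      rintro ⟨x, hx, hw⟩
      exact (ih ⟨x, hx, .head h2 hw⟩).tail ⟨h2, ⟨x, hx, hw⟩, a, ha, hau.trans h1⟩
  refine ⟨A', fun a ha => ha.1, M', fun x y h => h.1, ?_, ?_⟩
  · refine ⟨⟨fun x y hxy => h.sub hxy.1, fun x y z h1 h2 => h.lu h1.1 h2.1,
      fun x y z h1 h2 => h.ru h1.1 h2.1, fun x y hx hxy => h.out hx hxy.1, ?_⟩, ?_, ?_, ?_, ?_⟩
    · intro x hx
      obtain ⟨a, ha, hax, hlast⟩ := h.exists_last hx
      have ha' : a ∈ A' := ⟨ha, ⟨x, hx, hax⟩, hlast⟩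
      exact ⟨a, ha', lift ha' .refl hax ⟨x, hx, .refl⟩⟩
    · rintro a y ha ⟨hya, -, a', ha', ha'y⟩
      rcases ha'y.cases_head with rfl | ⟨d, hd, hdy⟩
      · exact ha'.2.2 a ha.1 a hya .refl
      · exact ha'.2.2 a ha.1 d hd (hdy.tail hya)
    · intro a ha
      obtain ⟨x, hx, hax⟩ := ha.2.1
      exact ⟨x, hx, lift ha .refl hax ⟨x, hx, .refl⟩⟩
    · rintro x y ⟨hxy, ⟨z, hz, hyz⟩, a, ha, hax⟩
      exact ⟨a, ha, lift ha .refl hax ⟨z, hz, .head hxy hyz⟩⟩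
    · rintro x y ⟨hxy, ⟨z, hz, hyz⟩, a, ha, hax⟩
      exact ⟨z, hz, lift ha (hax.tail hxy) hyz ⟨z, hz, .refl⟩⟩
  · intro hA
    refine Set.Subset.antisymm (fun a ha => ha.1) fun a ha => ⟨ha, (hA a ha).2, ?_⟩
    intro w hw d had hdw
    have hd : ReflTransGen M a w := .head had hdw
    rcases hdw.cases_tail with rfl | ⟨e, -, he⟩
    · exact (hA _ hw).1 a had
    · exact (hA _ hw).1 e he

theorem IsLink.encard_eq {G M : V → V → Prop} {A X : Set V} (h : IsLink G A X M) :
    A.encard = X.encard := by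
  classical
  choose! g hgA hg using h.reach
  have him : g '' X = A := by
    refine Set.Subset.antisymm (by rintro _ ⟨x, hx, rfl⟩; exact hgA hx) fun a ha => ?_
    obtain ⟨x, hx, hax⟩ := h.fwd ha
    exact ⟨x, hx, h.source_unique (hgA hx) ha (hg hx) hax⟩
  rw [← him]
  refine Set.InjOn.encard_image fun x hx y hy hxy => ?_
  exact h.target_unique hx hy (hg hx) (hxy ▸ hg hy)

/-- Removing the path from `a` to `x`. -/
theorem IsLink.erase {G M : V → V → Prop} {A X : Set V} (h : IsLink G A X M) {a x : V}
    (ha : a ∈ A) (hx : x ∈ X) (hax : ReflTransGen M a x) :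
    IsLink G (A \ {a}) (X \ {x}) (fun u w => M u w ∧ ¬ ReflTransGen M w x) := by
  have lift : ∀ {u w : V}, ReflTransGen M u w → ¬ ReflTransGen M u x →
      ReflTransGen (fun u w => M u w ∧ ¬ ReflTransGen M w x) u w := by
    intro u w huw hu
    induction huw with
    | refl => exact .refl
    | tail h1 h2 ih =>
      rename_i b c
      refine ih.tail ⟨h2, fun hcx => hu ((h1.tail h2).trans hcx)⟩
  refine ⟨⟨fun u w hu => h.sub hu.1, fun u w z h1 h2 => h.lu h1.1 h2.1,
      fun u w z h1 h2 => h.ru h1.1 h2.1, fun u w hu huw => h.out hu.1 huw.1, ?_⟩, ?_, ?_, ?_, ?_⟩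
  · rintro z ⟨hz, hzx⟩
    obtain ⟨c, hc, hcz⟩ := h.reach hz
    refine ⟨c, ⟨hc, ?_⟩, lift hcz fun hcx => hzx (h.target_unique hz hx hcz hcx)⟩
    rintro rfl
    exact hzx (h.target_unique hz hx hcz hax)
  · exact fun c y hc hy => h.noin hc.1 hy.1
  · rintro c ⟨hc, hca⟩
    obtain ⟨z, hz, hcz⟩ := h.fwd hc
    have hcx : ¬ ReflTransGen M c x := fun hcx => hca (h.source_unique hc ha hcx hax)
    refine ⟨z, ⟨hz, ?_⟩, lift hcz hcx⟩
    rintro rfl; exact hcx hcz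
  · rintro u w ⟨huw, hwx⟩
    have hu : ¬ ReflTransGen M u x := by
      intro hux
      rcases hux.cases_head with rfl | ⟨d, hd, hdx⟩
      · exact h.out hx huw
      · exact hwx (h.ru huw hd ▸ hdx)
    obtain ⟨c, hc, hcu⟩ := h.src huw
    have hcx : ¬ ReflTransGen M c x := by
      intro hcx
      exact hu (h.before_target hx hcx hcu)
    refine ⟨c, ⟨hc, ?_⟩, lift hcu hcx⟩
    rintro rfl; exact hcx hax
  · rintro u w ⟨huw, hwx⟩
    obtain ⟨z, hz, hwz⟩ := h.tgt huw
    refine ⟨z, ⟨hz, ?_⟩, lift hwz hwx⟩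
    rintro rfl; exact hwx hwz

theorem exists_nodup_isChain {K : V → V → Prop} {a b : V} (h : ReflTransGen K a b) :
    ∃ l : List V, l.Nodup ∧ l.IsChain K ∧ l.head? = some a ∧ l.getLast? = some b := by
  induction h with
  | refl => exact ⟨[a], by simp⟩
  | tail hab hbc ih =>
    rename_i b c
    obtain ⟨l, hn, hc, hh, hl⟩ := ih
    by_cases hcl : c ∈ l
    · obtain ⟨s, t, rfl⟩ := List.append_of_mem hcl
      have e : s ++ c :: t = (s ++ [c]) ++ t := by simp
      rw [e] at hn hc hh
      refine ⟨s ++ [c], hn.of_append_left, (List.isChain_append.1 hc).1, ?_, by simp⟩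
      cases s <;> simpa using hh
    · refine ⟨l ++ [c], ?_, ?_, ?_, by simp⟩
      · rw [List.nodup_append]
        refine ⟨hn, by simp, ?_⟩
        rintro x hx y hy rfl
        simp only [List.mem_singleton] at hy
        exact hcl (hy ▸ hx)
      · rw [List.isChain_append]
        refine ⟨hc, by simp, ?_⟩
        intro x hx y hy
        rw [hl] at hx
        simp at hx hy
        subst hx hy; exact hbc
      · cases l with
        | nil => simp at hh
        | cons x l => simpa using hh

end Linkages

section Augmentation
open Relation

theorem exists_isLink_of_reflTransGen {K : V → V → Prop} {a b : V} (h : ReflTransGen K a b) :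
    ∃ E, IsLink K {a} {b} E := by
  obtain ⟨l, hn, hc, hh, hl⟩ := exists_nodup_isChain h
  set E : V → V → Prop := fun x y => ∃ i, ∃ h : i + 1 < l.length, l[i] = x ∧ l[i + 1] = y
    with hE
  have h0 : 0 < l.length := by
    cases l with
    | nil => simp at hh
    | cons => simp
  have ha : l[0] = a := by
    cases l with
    | nil => simp at hh
    | cons => simpa using hh
  have hb : l[l.length - 1] = b := by
    rw [List.getLast?_eq_getElem?] at hl
    rw [List.getElem?_eq_getElem (by omega)] at hl
    simpa using hl
  have hcov : IsCov K {a} {b} E := by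
    refine ⟨?_, ?_, ?_, ?_, ?_⟩
    · rintro x y ⟨i, hi, rfl, rfl⟩
      exact List.isChain_iff_getElem.1 hc i hi
    · rintro x y z ⟨i, hi, rfl, h1⟩ ⟨j, hj, rfl, h2⟩
      have := (hn.getElem_inj_iff).1 (h1.trans h2.symm)
      have : i = j := by omega
      subst this; rfl
    · rintro x y z ⟨i, hi, h1, rfl⟩ ⟨j, hj, h2, rfl⟩
      have := (hn.getElem_inj_iff).1 (h1.trans h2.symm)
      subst this; rfl
    · rintro x y hx ⟨i, hi, h1, -⟩
      rw [Set.mem_singleton_iff.1 hx, ← hb] at h1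
      have := (hn.getElem_inj_iff).1 h1
      omega
    · rintro x hx
      rw [Set.mem_singleton_iff.1 hx, ← hb]
      refine ⟨a, rfl, ?_⟩
      have key : ∀ i (hi : i < l.length), ReflTransGen E a l[i] := by
        intro i
        induction i with
        | zero => intro hi; rw [ha]
        | succ i ih => exact fun hi => (ih (by omega)).tail ⟨i, hi, rfl, rfl⟩
      exact key _ _
  obtain ⟨A', hA', E', -, hE', -⟩ := hcov.exists_isLink
  obtain ⟨c, hc, -⟩ := hE'.reach (Set.mem_singleton b)
  have : A' = {a} := (Set.subset_singleton_iff_eq.1 hA').resolve_left fun h => by simp [h] at hc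
  exact ⟨E', this ▸ hE'⟩

theorem orbit_injective {f : V → V} {x : V} {P : Set V} (hinj : Set.InjOn f P)
    (hx : ∀ y ∈ P, f y ≠ x) (hP : ∀ n, f^[n] x ∈ P) : Function.Injective fun n => f^[n] x := by
  have key : ∀ i k, f^[i] x = f^[i + (k + 1)] x → False := by
    intro i
    induction i with
    | zero =>
      intro k h
      rw [Nat.zero_add, Function.iterate_succ_apply'] at h
      exact hx _ (hP k) h.symm
    | succ i ih =>
      intro k h
      rw [Function.iterate_succ_apply', show i + 1 + (k + 1) = (i + (k + 1)) + 1 by omega,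
        Function.iterate_succ_apply'] at h
      exact ih k (hinj (hP _) (hP _) h)
  intro i j hij
  rcases lt_trichotomy i j with h | h | h
  · obtain ⟨k, rfl⟩ := Nat.exists_eq_add_of_lt h
    exact (key i k hij).elim
  · exact h
  · obtain ⟨k, rfl⟩ := Nat.exists_eq_add_of_lt h
    exact (key j k hij.symm).elim

theorem orbit_leaves {f : V → V} {x : V} {P : Set V} (hinj : Set.InjOn f P)
    (hx : ∀ y ∈ P, f y ≠ x) (hP : ∀ n, f^[n] x ∈ P) {S : Set V} (hS : S.Finite) :
    ∃ N, ∀ n ≥ N, f^[n] x ∉ S := by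
  have h := (orbit_injective hinj hx hP).tendsto_cofinite.eventually hS.eventually_cofinite_notMem
  rw [Nat.cofinite_eq_atTop, Filter.eventually_atTop] at h
  exact h

theorem IsLink.no_ray_right {G M : V → V → Prop} {A X : Set V} (h : IsLink G A X M) (s : ℕ → V)
    (hs : ∀ n, M (s n) (s (n + 1))) : False := by
  obtain ⟨x, hx, h0⟩ := h.tgt (hs 0)
  have key : ∀ n, ReflTransGen M (s (n + 1)) x := by
    intro n
    induction n with
    | zero => exact h0
    | succ n ih =>
      rcases ih.cases_head with h' | ⟨d, hd, hdx⟩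
      · exact absurd (hs (n + 1)) (h.out (h' ▸ hx))
      · rwa [h.ru (hs (n + 1)) hd]
  obtain ⟨n, hn⟩ : ∃ n, s n = x := by
    have : ∀ y, ReflTransGen M y x → (∃ n, s n = y) → ∃ n, s n = x := by
      intro y hy
      induction hy using ReflTransGen.head_induction_on with
      | refl => exact id
      | head hcd _ ih =>
        rintro ⟨n, rfl⟩
        exact ih ⟨n + 1, h.ru (hs n) hcd⟩
    exact this _ h0 ⟨1, rfl⟩
  exact h.out hx (hn ▸ hs n)

/-- The closure property of the set of vertices from which an alternating walk starting at `a`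
can be continued. -/
def AugClosed (G : V → V → Prop) (A : Set V) (M : V → V → Prop) (a : V) (R : Set V) : Prop :=
  ∀ w, w ∉ A → (w = a ∨ ∃ u ∈ R, w = u ∨ G u w) →
    (∀ z, M z w → z ∈ R) ∧ ((∀ z, ¬ M z w) → w ∈ R)

theorem IsLink.augment {G M : V → V → Prop} {A X : Set V} (h : IsLink G A X M) {a : V}
    (ha : a ∉ A) : ∃ R : Set V, AugClosed G A M a R ∧ (∀ u ∈ R, u ∉ X) ∧
      ∀ b ∈ R, ∃ M', IsLink G (insert a A) (insert b X) M' := by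
  classical
  obtain ⟨q, hq1, hq2⟩ : ∃ q : V → V, (∀ z w, M z w → q w = z) ∧
      ∀ w, (∀ z, ¬ M z w) → q w = w := by
    refine ⟨fun w => if hw : ∃ z, M z w then hw.choose else w, fun z w hzw => ?_, fun w hw => ?_⟩
    · have hw : ∃ z, M z w := ⟨z, hzw⟩
      simp only [dif_pos hw]
      exact h.lu hw.choose_spec hzw
    · have hw' : ¬ ∃ z, M z w := by simpa using hw
      simp only [dif_neg hw']
  have hqne : ∀ w, q w ≠ w → M (q w) w := by
    intro w hw
    by_cases hz : ∃ z, M z w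
    · obtain ⟨z, hz⟩ := hz
      rwa [hq1 z w hz]
    · exact absurd (hq2 w (by simpa using hz)) hw
  have hqinj : Set.InjOn q Aᶜ := by
    have aux : ∀ w w', w' ∉ A → q w = q w' → (∃ z, M z w) → (∀ z, ¬ M z w') → False := by
      rintro w w' hw' hww ⟨z, hz⟩ hno
      rw [hq1 z w hz, hq2 w' hno] at hww
      obtain ⟨c, hc, hcz⟩ := h.src hz
      rw [hww] at hcz
      exact hw' (eq_of_reflTransGen_of_no_in hcz hno ▸ hc)
    intro w hw w' hw' hww
    by_cases h1 : ∃ z, M z w <;> by_cases h2 : ∃ z, M z w'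
    · obtain ⟨z, hz⟩ := h1
      obtain ⟨z', hz'⟩ := h2
      rw [hq1 z w hz, hq1 z' w' hz'] at hww
      exact h.ru hz (hww ▸ hz')
    · exact (aux w w' hw' hww h1 (by simpa using h2)).elim
    · exact (aux w' w hw hww.symm h2 (by simpa using h1)).elim
    · rwa [hq2 w (by simpa using h1), hq2 w' (by simpa using h2)] at hww
  have hqX : ∀ w, w ∉ A → q w ∉ X := by
    intro w hw hX
    by_cases h1 : ∃ z, M z w
    · obtain ⟨z, hz⟩ := h1
      rw [hq1 z w hz] at hX
      exact h.out hX hz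
    · have h1 : ∀ z, ¬ M z w := by simpa using h1
      rw [hq2 w h1] at hX
      obtain ⟨c, hc, hcw⟩ := h.reach hX
      exact hw (eq_of_reflTransGen_of_no_in hcw h1 ▸ hc)
  have hqsurj : ∀ y, y ∉ X → ∃ w, w ∉ A ∧ q w = y := by
    intro y hy
    by_cases h1 : ∃ z, M y z
    · obtain ⟨z, hz⟩ := h1
      exact ⟨z, fun hzA => h.noin hzA hz, hq1 _ _ hz⟩
    · have h1 : ∀ z, ¬ M y z := by simpa using h1
      refine ⟨y, fun hyA => ?_, hq2 y fun z hz => ?_⟩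
      · obtain ⟨x, hx, hyx⟩ := h.fwd hyA
        exact hy (eq_of_reflTransGen_of_no_out hyx h1 ▸ hx)
      · obtain ⟨x, hx, hyx⟩ := h.tgt hz
        exact hy (eq_of_reflTransGen_of_no_out hyx h1 ▸ hx)
  set K : V → V → Prop := fun u u' => ∃ w, w ∉ A ∧ (w = u ∨ G u w) ∧ u' = q w with hK
  have hRX : ∀ u, ReflTransGen K (q a) u → u ∉ X := by
    intro u hu
    rcases hu.cases_tail with rfl | ⟨d, -, w, hw, -, rfl⟩
    · exact hqX a ha
    · exact hqX w hw
  refine ⟨{u | ReflTransGen K (q a) u}, ?_, hRX, ?_⟩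
  · have aux : ∀ w, ReflTransGen K (q a) (q w) → (∀ z, M z w → ReflTransGen K (q a) z) ∧
        ((∀ z, ¬ M z w) → ReflTransGen K (q a) w) := fun w hw =>
      ⟨fun z hz => by rwa [hq1 z w hz] at hw, fun hz => by rwa [hq2 w hz] at hw⟩
    rintro w hw (rfl | ⟨u, hu, huw⟩)
    · exact aux w .refl
    · exact aux w (ReflTransGen.tail hu ⟨w, hw, huw, rfl⟩)
  intro b hb
  have hbX : b ∉ X := hRX b hb
  obtain ⟨l, hn, hc, hh, hl⟩ := exists_nodup_isChain hb
  have h0 : 0 < l.length := by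
    cases l with
    | nil => simp at hh
    | cons => simp
  have hla : l[0] = q a := by
    cases l with
    | nil => simp at hh
    | cons => simpa using hh
  have hlb : l[l.length - 1] = b := by
    rw [List.getLast?_eq_getElem?] at hl
    rw [List.getElem?_eq_getElem (by omega)] at hl
    simpa using hl
  have hlR : ∀ i (hi : i < l.length), ReflTransGen K (q a) l[i] := by
    intro i
    induction i with
    | zero => intro hi; rw [hla]
    | succ i ih => exact fun hi => (ih (by omega)).tail (List.isChain_iff_getElem.1 hc i hi)
  have hlX : ∀ u ∈ l, u ∉ X := by
    intro u hu
    obtain ⟨i, hi, rfl⟩ := List.getElem_of_mem hu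
    exact hRX _ (hlR i hi)
  set σ := l.formPerm with hσ
  have hσb : σ b = q a := by
    have := List.formPerm_apply_getElem_length (l.head (List.ne_nil_of_length_pos h0)) l.tail
    simp only [List.cons_head_tail] at this
    rw [← hla, ← List.head_eq_getElem (List.ne_nil_of_length_pos h0), ← this]
    congr 1
    rw [← hlb]
    congr 1
    simp
  have hσX : ∀ u, u ∉ X → σ u ∉ X := by
    intro u hu
    by_cases hul : u ∈ l
    · exact hlX _ (List.formPerm_apply_mem_of_mem hul)
    · rwa [hσ, List.formPerm_apply_of_notMem hul]
  have hσX' : ∀ u, u ∈ X → σ u = u := fun u hu =>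
    List.formPerm_apply_of_notMem fun hul => hlX u hul hu
  have hσl : ∀ u, σ u ∉ l → σ u = u := by
    intro u hu
    exact List.formPerm_apply_of_notMem fun hul => hu (List.formPerm_apply_mem_of_mem hul)
  have hM'G : ∀ u w, u ≠ w → w ∉ insert a A → σ u = q w → G u w := by
    intro u w huw hw hu
    have hwA : w ∉ A := fun h => hw (Set.mem_insert_of_mem _ h)
    by_cases hul : u ∈ l
    · obtain ⟨i, hi, rfl⟩ := List.getElem_of_mem hul
      by_cases hi' : i + 1 < l.length
      · rw [hσ, List.formPerm_apply_lt_getElem _ hn _ hi'] at hu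
        obtain ⟨w', hw', h1, h2⟩ := List.isChain_iff_getElem.1 hc i hi'
        have := hqinj hwA hw' (hu.symm.trans h2)
        subst this
        exact h1.resolve_left (Ne.symm huw)
      · have : l[i] = b := by rw [← hlb]; congr 1; omega
        rw [this, hσb] at hu
        exact absurd (Set.mem_insert_iff.2 (.inl (hqinj ha hwA hu).symm)) hw
    · rw [hσ, List.formPerm_apply_of_notMem hul] at hu
      exact h.sub (by rw [hu]; exact hqne w (hu ▸ huw))
  set p : V → V := fun w => σ.symm (q w) with hp
  have hpσ : ∀ w, σ (p w) = q w := fun w => σ.apply_symm_apply _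
  have hpinj : Set.InjOn p (insert a A)ᶜ := by
    intro w hw w' hw' hww
    refine hqinj (fun h => hw (Set.mem_insert_of_mem _ h))
      (fun h => hw' (Set.mem_insert_of_mem _ h)) ?_
    rw [← hpσ, ← hpσ, hww]
  have hpX : ∀ w, w ∉ insert a A → p w ∉ insert b X := by
    intro w hw hX
    have hwA : w ∉ A := fun h => hw (Set.mem_insert_of_mem _ h)
    rcases hX with hX | hX
    · have := hpσ w
      rw [hX, hσb] at this
      exact hw (.inl (hqinj ha hwA this).symm)
    · have := hpσ w
      rw [hσX' _ hX] at this
      exact hqX w hwA (this ▸ hX)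
  obtain ⟨f, hf1, hf2⟩ : ∃ f : V → V, (∀ y, y ∉ insert b X → f y ∉ insert a A) ∧
      ∀ y, y ∉ insert b X → p (f y) = y := by
    have : ∀ y, ∃ w, y ∉ insert b X → w ∉ insert a A ∧ p w = y := by
      intro y
      by_cases hy : y ∈ insert b X
      · exact ⟨y, fun h => absurd hy h⟩
      · obtain ⟨w, hw, hwq⟩ := hqsurj (σ y) (hσX y fun h => hy (Set.mem_insert_of_mem _ h))
        refine ⟨w, fun _ => ⟨?_, by rw [hp]; simp [hwq]⟩⟩
        rintro (rfl | hwA)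
        · rw [← hσb] at hwq
          exact hy (.inl (σ.injective hwq).symm)
        · exact hw hwA
    choose f hf using this
    exact ⟨f, fun y hy => (hf y hy).1, fun y hy => (hf y hy).2⟩
  have hfinj : Set.InjOn f (insert b X)ᶜ := by
    intro y hy z hz hyz
    rw [← hf2 y hy, hyz, hf2 z hz]
  set M' : V → V → Prop := fun u w => u ≠ w ∧ w ∉ insert a A ∧ u = p w with hM'
  have hcov : IsCov G (insert a A) (insert b X) M' := by
    refine ⟨?_, ?_, ?_, ?_, ?_⟩
    · rintro u w ⟨huw, hw, rfl⟩
      exact hM'G _ w huw hw (hpσ w)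
    · rintro x y z ⟨-, -, h1⟩ ⟨-, -, h2⟩
      exact h1.trans h2.symm
    · rintro x y z ⟨-, hy, h1⟩ ⟨-, hz, h2⟩
      exact hpinj hy hz (h1.symm.trans h2)
    · rintro x y hx ⟨-, hy, rfl⟩
      exact hpX y hy hx
    · intro x hx
      have hne : ∀ y ∈ (insert a A)ᶜ, p y ≠ x := fun y hy h => hpX y hy (h ▸ hx)
      have hex : ∃ n, p^[n] x ∈ insert a A := by
        by_contra hno
        push Not at hno
        obtain ⟨N, hN⟩ := orbit_leaves hpinj hne hno l.finite_toSet
        have hstep : ∀ n ≥ N, M (p^[n + 1] x) (p^[n] x) := by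
          intro n hn
          have e : p^[n + 1] x = q (p^[n] x) := by
            rw [Function.iterate_succ_apply', ← hpσ]
            have := hN (n + 1) (by omega)
            rw [Function.iterate_succ_apply'] at this
            exact (List.formPerm_apply_of_notMem this).symm
          rw [e]
          refine hqne _ ?_
          rw [← e]
          exact fun h => absurd (orbit_injective hpinj hne hno h) (by simp)
        exact h.swap.no_ray_right (fun n => p^[N + n] x) fun n => hstep (N + n) (by omega)
      have hall : ∀ n, (∀ m < n, p^[m] x ∉ insert a A) → ReflTransGen M' (p^[n] x) x := by
        intro n
        induction n with
        | zero => exact fun _ => .refl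
        | succ n ih =>
          intro hm
          have h1 := ih fun m hmn => hm m (by omega)
          rw [Function.iterate_succ_apply']
          by_cases he : p (p^[n] x) = p^[n] x
          · rwa [he]
          · exact .head ⟨he, hm n (by omega), rfl⟩ h1
      exact ⟨_, Nat.find_spec hex, hall _ fun m hm => Nat.find_min hex hm⟩
  obtain ⟨A', hA', M'', -, hM'', hA⟩ := hcov.exists_isLink
  refine ⟨M'', hA ?_ ▸ hM''⟩
  intro c hc
  refine ⟨fun y hy => hy.2.1 hc, ?_⟩
  have hne : ∀ y ∈ (insert b X)ᶜ, f y ≠ c := fun y hy h => hf1 y hy (h ▸ hc)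
  have hex : ∃ n, f^[n] c ∈ insert b X := by
    by_contra hno
    push Not at hno
    obtain ⟨N, hN⟩ := orbit_leaves hfinj hne hno l.finite_toSet
    have hstep : ∀ n ≥ N, M (f^[n] c) (f^[n + 1] c) := by
      intro n hn
      have e : q (f^[n + 1] c) = f^[n] c := by
        rw [Function.iterate_succ_apply', ← hpσ, hf2 _ (hno n)]
        exact List.formPerm_apply_of_notMem (hN n hn)
      have : q (f^[n + 1] c) ≠ f^[n + 1] c := by
        rw [e]
        exact fun h => absurd (orbit_injective hfinj hne hno h) (by simp)
      simpa only [e] using hqne _ this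
    exact h.no_ray_right (fun n => f^[N + n] c) fun n => hstep (N + n) (by omega)
  have hall : ∀ n, (∀ m < n, f^[m] c ∉ insert b X) → ReflTransGen M' c (f^[n] c) := by
    intro n
    induction n with
    | zero => exact fun _ => .refl
    | succ n ih =>
      intro hm
      have h1 := ih fun m hmn => hm m (by omega)
      rw [Function.iterate_succ_apply']
      by_cases he : f^[n] c = f (f^[n] c)
      · rwa [← he]
      · exact .tail h1 ⟨he, hf1 _ (hm n (by omega)), (hf2 _ (hm n (by omega))).symm⟩
  exact ⟨_, Nat.find_spec hex, hall _ fun m hm => Nat.find_min hex hm⟩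

/-- Restriction of a relation to a set. -/
def res (G : V → V → Prop) (C : Set V) : V → V → Prop := fun x y => G x y ∧ x ∈ C ∧ y ∈ C

/-- Deletion of a set of vertices. -/
def del (G : V → V → Prop) (T : Set V) : V → V → Prop := fun x y => G x y ∧ x ∉ T ∧ y ∉ T

/-- The vertices of `C` that lie in `B` or have a `G`-successor outside `C`. -/
def bd (G : V → V → Prop) (B C : Set V) : Set V := {c | c ∈ C ∧ (c ∈ B ∨ ∃ d, d ∉ C ∧ G c d)}

/-- The set of vertices visited by a failed augmentation. -/
def augSet (G : V → V → Prop) (a : V) (R : Set V) : Set V :=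
  insert a (R ∪ {w | ∃ u ∈ R, G u w})

theorem subset_augSet {G : V → V → Prop} {a : V} {R : Set V} : R ⊆ augSet G a R :=
  fun _ h => .inr (.inl h)

theorem augSet_succ {G : V → V → Prop} {a u w : V} {R : Set V} (hu : u ∈ R) (h : G u w) :
    w ∈ augSet G a R := .inr (.inr ⟨u, hu, h⟩)

theorem IsLink.cov_of_augClosed {G M : V → V → Prop} {A X : Set V} (h : IsLink G A X M) {a : V}
    {R : Set V} (hR : AugClosed G A M a R) :
    IsCov (res G (augSet G a R)) (A ∩ augSet G a R) (augSet G a R \ R)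
      (fun u w => M u w ∧ w ∈ augSet G a R) := by
  have hcl : ∀ w ∈ augSet G a R, w ∉ A → (∀ z, M z w → z ∈ R) ∧ ((∀ z, ¬ M z w) → w ∈ R) := by
    rintro w (rfl | hw | ⟨u, hu, huw⟩) hwA
    · exact hR w hwA (.inl rfl)
    · exact hR w hwA (.inr ⟨w, hw, .inl rfl⟩)
    · exact hR w hwA (.inr ⟨u, hu, .inr huw⟩)
  have hpred : ∀ z w, M z w → w ∈ augSet G a R → z ∈ R := fun z w hzw hw =>
    (hcl w hw fun hwA => h.noin hwA hzw).1 z hzw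
  refine ⟨fun x y hxy => ⟨h.sub hxy.1, subset_augSet (hpred _ _ hxy.1 hxy.2), hxy.2⟩,
    fun x y z h1 h2 => h.lu h1.1 h2.1, fun x y z h1 h2 => h.ru h1.1 h2.1,
    fun x y hx hxy => hx.2 (hpred _ _ hxy.1 hxy.2), ?_⟩
  rintro z ⟨hz, hzR⟩
  by_cases hzA : z ∈ A
  · exact ⟨z, ⟨hzA, hz⟩, .refl⟩
  · have : ∃ y, M y z := by
      by_contra hno
      exact hzR ((hcl z hz hzA).2 (by simpa using hno))
    obtain ⟨y, hy⟩ := this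
    obtain ⟨c, hc, hcy⟩ := h.src hy
    have key : ∀ u, ReflTransGen M c u → u ∈ augSet G a R →
        c ∈ augSet G a R ∧ ReflTransGen (fun u w => M u w ∧ w ∈ augSet G a R) c u := by
      intro u hu
      induction hu with
      | refl => exact fun h => ⟨h, .refl⟩
      | tail h1 h2 ih =>
        intro hd
        have := ih (subset_augSet (hpred _ _ h2 hd))
        exact ⟨this.1, this.2.tail ⟨h2, hd⟩⟩
    have := key z (hcy.tail hy) hz
    exact ⟨c, ⟨hc, this.1⟩, this.2⟩

theorem bd_augSet {G : V → V → Prop} {a : V} {R B : Set V} (hB : ∀ u ∈ R, u ∉ B) :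
    bd G B (augSet G a R) ⊆ augSet G a R \ R := by
  rintro c ⟨hc, h⟩
  refine ⟨hc, fun hcR => ?_⟩
  rcases h with h | ⟨d, hd, hcd⟩
  · exact hB c hcR h
  · exact hd (augSet_succ hcR hcd)

end Augmentation

section Waves
open Relation

theorem AugClosed.inter {G M : V → V → Prop} {A R S : Set V} {a : V}
    (h : AugClosed (res G S) A M a R) (ha : a ∈ S) (hM : ∀ x y, M x y → x ∈ S) :
    AugClosed (res G S) A M a (R ∩ S) := by
  intro w hw hwa
  have h1 := h w hw (hwa.imp id fun ⟨u, hu, h⟩ => ⟨u, hu.1, h⟩)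
  refine ⟨fun z hz => ⟨h1.1 z hz, hM z w hz⟩, fun hno => ⟨h1.2 hno, ?_⟩⟩
  rcases hwa with rfl | ⟨u, hu, rfl | h⟩
  · exact ha
  · exact hu.2
  · exact h.2.2

theorem augSet_res_subset {G : V → V → Prop} {R S : Set V} {a : V} (ha : a ∈ S) (hR : R ⊆ S) :
    augSet (res G S) a R ⊆ S := by
  rintro w (rfl | hw | ⟨u, hu, huw⟩)
  · exact ha
  · exact hR hw
  · exact huw.2.2

theorem IsLink.augment_res {G M : V → V → Prop} {A X S : Set V} (h : IsLink (res G S) A X M) {a : V}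
    (ha : a ∉ A) (haS : a ∈ S) : ∃ R ⊆ S, AugClosed (res G S) A M a R ∧ (∀ u ∈ R, u ∉ X) ∧
      ∀ b ∈ R, ∃ M', IsLink (res G S) (insert a A) (insert b X) M' := by
  obtain ⟨R, h1, h2, h3⟩ := h.augment ha
  exact ⟨R ∩ S, Set.inter_subset_right, h1.inter haS fun x y hxy => (h.sub hxy).2.1,
    fun u hu => h2 u hu.1, fun b hb => h3 b hb.1⟩

theorem IsCov.union_trivial {G M : V → V → Prop} {A A' Z C C' : Set V} (h : IsCov (res G C) A Z M)
    (hA : A ⊆ A') (hC : C ⊆ C') : IsCov (res G C') A' (Z ∪ (A' \ C)) M := by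
  refine ⟨fun x y hxy => ⟨(h.sub hxy).1, hC (h.sub hxy).2.1, hC (h.sub hxy).2.2⟩, h.lu, h.ru,
    ?_, ?_⟩
  · rintro x y (hx | hx) hxy
    · exact h.out hx hxy
    · exact hx.2 (h.sub hxy).2.1
  · rintro x (hx | hx)
    · obtain ⟨a, ha, hax⟩ := h.reach hx
      exact ⟨a, hA ha, hax⟩
    · exact ⟨x, hx.1, .refl⟩

/-- Continuing the paths of `M` by the parts of the paths of `M'` outside of `C`. -/
theorem IsCov.ext {G G' H M M' : V → V → Prop} {A C X Z Z' : Set V} (hM : IsCov G A Z M)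
    (hMC : ∀ x y, M x y → x ∈ C ∧ y ∈ C) (hM' : IsCov G' C X M')
    (hGH : ∀ x y, M x y → H x y) (hGH' : ∀ x y, M' x y → y ∉ C → H x y)
    (hZ : ∀ x y, M' x y → x ∈ C → y ∉ C → x ∈ Z)
    (hZZ : Z' ⊆ Z) (hZ' : ∀ x ∈ Z', ∀ y, M' x y → y ∈ C) :
    IsCov H A (Z' ∪ (X \ C)) (fun x y => M x y ∨ (M' x y ∧ y ∉ C)) := by
  refine ⟨?_, ?_, ?_, ?_, ?_⟩
  · rintro x y (h | h)
    · exact hGH x y h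
    · exact hGH' x y h.1 h.2
  · rintro x y z (h | h) (h' | h')
    · exact hM.lu h h'
    · exact absurd (hMC _ _ h).2 h'.2
    · exact absurd (hMC _ _ h').2 h.2
    · exact hM'.lu h.1 h'.1
  · rintro x y z (h | h) (h' | h')
    · exact hM.ru h h'
    · exact absurd h (hM.out (hZ _ _ h'.1 (hMC _ _ h).1 h'.2))
    · exact absurd h' (hM.out (hZ _ _ h.1 (hMC _ _ h').1 h.2))
    · exact hM'.ru h.1 h'.1
  · rintro x y (hx | hx) (h | h)
    · exact hM.out (hZZ hx) h
    · exact h.2 (hZ' x hx y h.1)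
    · exact hx.2 (hMC _ _ h).1
    · exact hM'.out hx.1 h.1
  · have hmono : ∀ x y, ReflTransGen M x y →
        ReflTransGen (fun x y => M x y ∨ (M' x y ∧ y ∉ C)) x y := fun x y h =>
      ReflTransGen.mono (fun _ _ h => .inl h) _ _ h
    rintro x (hx | hx)
    · obtain ⟨a, ha, hax⟩ := hM.reach (hZZ hx)
      exact ⟨a, ha, hmono _ _ hax⟩
    · obtain ⟨c, hc, hcx⟩ := hM'.reach hx.1
      have key : ∀ x, ReflTransGen M' c x → x ∉ C →
          ∃ a ∈ A, ReflTransGen (fun x y => M x y ∨ (M' x y ∧ y ∉ C)) a x := by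
        intro x hx
        induction hx with
        | refl => exact fun h => absurd hc h
        | tail h1 h2 ih =>
          rename_i y x
          intro hxC
          by_cases hy : y ∈ C
          · obtain ⟨a, ha, hay⟩ := hM.reach (hZ _ _ h2 hy hxC)
            exact ⟨a, ha, (hmono _ _ hay).tail (.inr ⟨h2, hxC⟩)⟩
          · obtain ⟨a, ha, hay⟩ := ih hy
            exact ⟨a, ha, hay.tail (.inr ⟨h2, hxC⟩)⟩
      exact key x hcx hx.2

/-- `C` is a wave for `(G, A, B)`: the boundary of `C` is linked from `A` inside of `C`. -/
def Wave (G : V → V → Prop) (A B C : Set V) : Prop := A ⊆ C ∧ Cov (res G C) A (bd G B C)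

/-- The union of all waves. -/
def maxWave (G : V → V → Prop) (A B : Set V) : Set V := ⋃₀ {C | Wave G A B C}

/-- Some wave leaves a vertex of `A` unused. -/
def Hindered (G : V → V → Prop) (A B : Set V) : Prop :=
  ∃ C, ∃ a ∈ A, A ⊆ C ∧ Cov (res G C) (A \ {a}) (bd G B C)

theorem wave_self (G : V → V → Prop) (A B : Set V) : Wave G A B A :=
  ⟨subset_rfl, fun _ _ => False, fun _ _ h => h.elim, fun _ _ _ h => h.elim,
    fun _ _ _ h => h.elim, fun _ _ _ h => h, fun x hx => ⟨x, hx.1, .refl⟩⟩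

theorem Wave.subset_maxWave {G : V → V → Prop} {A B C : Set V} (h : Wave G A B C) :
    C ⊆ maxWave G A B := Set.subset_sUnion_of_mem h

theorem subset_maxWave {G : V → V → Prop} {A B : Set V} : A ⊆ maxWave G A B :=
  (wave_self G A B).subset_maxWave

theorem wave_maxWave (G : V → V → Prop) (A B : Set V) : Wave G A B (maxWave G A B) := by
  classical
  refine ⟨subset_maxWave, ?_⟩
  set W := {C // Wave G A B C} with hW
  let r : W → W → Prop := WellOrderingRel
  have hwf : WellFounded r := WellOrderingRel.isWellOrder.wf
  have htri : ∀ C C' : W, r C C' ∨ C = C' ∨ r C' C := fun C C' =>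
    trichotomous_of r C C'
  choose m hm using fun C : W => C.2.2
  have hmin : ∀ w : V, w ∈ maxWave G A B → ∃ C : W, w ∈ C.1 ∧ ∀ C' : W, w ∈ C'.1 → ¬ r C' C := by
    rintro w ⟨C, hC, hw⟩
    obtain ⟨C', h1, h2⟩ := hwf.has_min {C : W | w ∈ C.1} ⟨⟨C, hC⟩, hw⟩
    exact ⟨C', h1, h2⟩
  choose! f hf hfmin using fun (w : V) => (show ∃ C : W, w ∈ maxWave G A B →
    (w ∈ C.1 ∧ ∀ C' : W, w ∈ C'.1 → ¬ r C' C) by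
      by_cases hw : w ∈ maxWave G A B
      · obtain ⟨C, hC⟩ := hmin w hw
        exact ⟨C, fun _ => hC⟩
      · exact ⟨⟨A, wave_self G A B⟩, fun h => absurd h hw⟩)
  have hsub : ∀ C : W, C.1 ⊆ maxWave G A B := fun C => C.2.subset_maxWave
  have hbd : ∀ (C : W) c, c ∈ C.1 → c ∈ bd G B (maxWave G A B) → c ∈ bd G B C.1 := by
    rintro C c hc ⟨-, h | ⟨d, hd, hcd⟩⟩
    · exact ⟨hc, .inl h⟩
    · exact ⟨hc, .inr ⟨d, fun h => hd (hsub C h), hcd⟩⟩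
  refine ⟨fun u w => w ∈ maxWave G A B ∧ m (f w) u w, ?_, ?_, ?_, ?_, ?_⟩
  · rintro x y ⟨hy, hxy⟩
    have := (hm (f y)).sub hxy
    exact ⟨this.1, hsub _ this.2.1, hy⟩
  · rintro x y z ⟨-, h1⟩ ⟨-, h2⟩
    exact (hm (f z)).lu h1 h2
  · have aux : ∀ x y z, y ∈ maxWave G A B → z ∈ maxWave G A B → m (f y) x y → m (f z) x z →
        ¬ r (f y) (f z) := by
      intro x y z hy hz h1 h2 hr
      refine (hm (f y)).out ⟨((hm (f y)).sub h1).2.1, .inr ⟨z, fun h => ?_, ((hm (f z)).sub h2).1⟩⟩ h1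
      exact hfmin z hz _ h hr
    rintro x y z ⟨hy, h1⟩ ⟨hz, h2⟩
    rcases htri (f y) (f z) with h | h | h
    · exact (aux x y z hy hz h1 h2 h).elim
    · rw [← h] at h2
      exact (hm (f y)).ru h1 h2
    · exact (aux x z y hz hy h2 h1 h).elim
  · rintro x y hx ⟨hy, hxy⟩
    exact (hm (f y)).out (hbd _ _ ((hm (f y)).sub hxy).2.1 hx) hxy
  · have key : ∀ C : W, ∀ z, z ∈ maxWave G A B → f z = C → (∃ a ∈ A, ReflTransGen (m C) a z) →
        ∃ a ∈ A, ReflTransGen (fun u w => w ∈ maxWave G A B ∧ m (f w) u w) a z := by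
      intro C
      induction C using hwf.induction with
      | _ C ihC =>
      rintro z hz hfz ⟨a, ha, haz⟩
      induction haz with
      | refl => exact ⟨a, ha, .refl⟩
      | tail h1 h2 ih =>
        rename_i y z
        have hyC : y ∈ C.1 := ((hm C).sub h2).2.1
        have hy : y ∈ maxWave G A B := hsub C hyC
        have hyz : z ∈ maxWave G A B ∧ m (f z) y z := ⟨hz, hfz ▸ h2⟩
        suffices ∃ a ∈ A, ReflTransGen (fun u w => w ∈ maxWave G A B ∧ m (f w) u w) a y by
          obtain ⟨a, ha, hay⟩ := this
          exact ⟨a, ha, hay.tail hyz⟩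
        rcases htri (f y) C with h | h | h
        · refine ihC (f y) h y hy rfl ((hm (f y)).reach ⟨hf y hy, .inr ⟨z, fun hzy => ?_, ?_⟩⟩)
          · exact hfmin z hz _ hzy (hfz ▸ h)
          · exact ((hm C).sub h2).1
        · exact ih hy h
        · exact (hfmin y hy C hyC h).elim
    intro z hz
    exact key (f z) z hz.1 rfl ((hm (f z)).reach (hbd _ _ (hf z hz.1) hz))

theorem del_del (G : V → V → Prop) (S T : Set V) : del (del G S) T = del G (S ∪ T) := by
  ext x y
  simp only [del, Set.mem_union]
  tauto

theorem Wave.del_of_disjoint {G : V → V → Prop} {A B C S T : Set V} (hST : S ⊆ T)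
    (h : Wave (del G S) (A \ S) (B \ S) C) (hC : ∀ x ∈ T \ S, x ∉ C) :
    Wave (del G T) (A \ T) (B \ T) C := by
  refine ⟨fun x hx => h.1 ⟨hx.1, fun h => hx.2 (hST h)⟩, h.2.imp fun M hM => ?_⟩
  have hA : A \ S ⊆ A \ T := fun x hx => ⟨hx.1, fun hT => hC x ⟨hT, hx.2⟩ (h.1 hx)⟩
  refine hM.mono ?_ hA ?_
  · rintro x y - ⟨⟨h1, h2, h3⟩, hx, hy⟩
    exact ⟨⟨h1, fun hT => hC x ⟨hT, h2⟩ hx, fun hT => hC y ⟨hT, h3⟩ hy⟩, hx, hy⟩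
  · rintro c ⟨hc, h | ⟨d, hd, hcd⟩⟩
    · exact ⟨hc, .inl ⟨h.1, fun h' => h.2 (hST h')⟩⟩
    · exact ⟨hc, .inr ⟨d, hd, hcd.1, fun h => hcd.2.1 (hST h), fun h => hcd.2.2 (hST h)⟩⟩

theorem not_hindered_del_source {G : V → V → Prop} {A B : Set V} (h : ¬ Hindered G A B) {a : V}
    (ha : a ∈ A) : ¬ Hindered (del G {a}) (A \ {a}) (B \ {a}) := by
  rintro ⟨C, c, hc, hAC, M, hM⟩
  refine h ⟨insert a C, c, hc.1, fun x hx => ?_, M, ?_, hM.lu, hM.ru, ?_, ?_⟩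
  · by_cases hxa : x = a
    · exact .inl hxa
    · exact .inr (hAC ⟨hx, hxa⟩)
  · intro x y hxy
    have := hM.sub hxy
    exact ⟨this.1.1, .inr this.2.1, .inr this.2.2⟩
  all_goals
    have hbd : ∀ x, x ≠ a → x ∈ bd G B (insert a C) → x ∈ bd (del G {a}) (B \ {a}) C := by
      rintro x hxa ⟨hx, h⟩
      refine ⟨hx.resolve_left hxa, h.imp (fun h => ⟨h, hxa⟩) ?_⟩
      rintro ⟨d, hd, hxd⟩
      exact ⟨d, fun h => hd (.inr h), hxd, hxa, fun h => hd (.inl h)⟩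
  · intro x y hx hxy
    by_cases hxa : x = a
    · exact (hM.sub hxy).1.2.1 hxa
    · exact hM.out (hbd x hxa hx) hxy
  · intro x hx
    by_cases hxa : x = a
    · subst hxa
      exact ⟨x, ⟨ha, fun h => hc.2 h.symm⟩, .refl⟩
    · obtain ⟨b, hb, hbx⟩ := hM.reach (hbd x hxa hx)
      exact ⟨b, ⟨hb.1.1, hb.2⟩, hbx⟩

theorem not_hindered_del {G : V → V → Prop} {A B : Set V} (h : ¬ Hindered G A B) {x : V}
    (hx : x ∉ maxWave G A B) : ¬ Hindered (del G {x}) (A \ {x}) (B \ {x}) := by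
  have hxA : x ∉ A := fun h => hx (subset_maxWave h)
  rintro ⟨C, a, ha, hAC, M₀, hM₀⟩
  rw [Set.sdiff_singleton_eq_self hxA] at ha hAC hM₀
  set X := bd (del G {x}) (B \ {x}) C with hX
  obtain ⟨A₁, hA₁, M, -, hM, -⟩ := hM₀.exists_isLink
  set S := insert x C with hS
  have hM' : IsLink (res G S) A₁ X M := hM.mono fun u w _ h => ⟨h.1.1, .inr h.2.1, .inr h.2.2⟩
  have haS : a ∈ S := .inr (hAC ha)
  obtain ⟨R, hRS, hcl, hRX, hsucc⟩ := hM'.augment_res (fun h => (hA₁ h).2 rfl) haS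
  by_cases hxR : x ∈ R
  · obtain ⟨M', hM'⟩ := hsucc x hxR
    refine hx (Wave.subset_maxWave (C := S) ⟨fun c hc => .inr (hAC hc), M', ?_⟩ (.inl rfl))
    refine hM'.toIsCov.mono (fun _ _ _ h => h) ?_ ?_
    · exact Set.insert_subset ha fun c hc => (hA₁ hc).1
    · rintro c ⟨hc, h⟩
      by_cases hcx : c = x
      · exact .inl hcx
      · refine .inr ⟨hc.resolve_left hcx, h.imp (fun h => ⟨h, hcx⟩) ?_⟩
        rintro ⟨d, hd, hcd⟩
        exact ⟨d, fun h => hd (.inr h), hcd, hcx, fun h => hd (.inl h)⟩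
  · set C₀ := augSet (res G S) a R with hC₀
    have hC₀S : C₀ ⊆ S := augSet_res_subset haS hRS
    have hcov : IsCov (res G C₀) (A₁ ∩ C₀) (C₀ \ R) _ := (hM'.cov_of_augClosed hcl).mono
      (fun x y _ h => ⟨h.1.1, h.2⟩) subset_rfl subset_rfl
    refine h ⟨C₀ ∪ A, a, ha, Set.subset_union_right, _,
      (hcov.union_trivial (A' := A \ {a}) (fun c hc => hA₁ hc.1) Set.subset_union_left).mono
      (fun _ _ _ h => h) subset_rfl ?_⟩
    rintro c ⟨hc, h⟩
    by_cases hcC : c ∈ C₀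
    · refine .inl ⟨hcC, fun hcR => ?_⟩
      have hcx : c ≠ x := by rintro rfl; exact hxR hcR
      have hcC' : c ∈ C := (hRS hcR).resolve_left hcx
      rcases h with h | ⟨d, hd, hcd⟩
      · exact hRX c hcR ⟨hcC', .inl ⟨h, hcx⟩⟩
      · by_cases hdS : d ∈ S
        · exact hd (.inl (augSet_succ hcR ⟨hcd, hRS hcR, hdS⟩))
        · exact hRX c hcR ⟨hcC', .inr ⟨d, fun h => hdS (.inr h), hcd, hcx, fun h => hdS (.inl h)⟩⟩
    · refine .inr ⟨⟨hc.resolve_left hcC, ?_⟩, hcC⟩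
      rintro rfl
      exact hcC (.inl rfl)

theorem exists_path_not_hindered [Countable V] {G : V → V → Prop} {A B : Set V}
    (h : ¬ Hindered G A B) {a : V} (ha : a ∈ A) : ∃ T : Set V, a ∈ T ∧ (∀ x ∈ T, x ∈ A → x = a) ∧
      (∃ b ∈ B ∩ T, ReflTransGen (res G T) a b) ∧ ¬ Hindered (del G T) (A \ T) (B \ T) := by
  have : Nonempty V := ⟨a⟩
  obtain ⟨f, hf⟩ := exists_surjective_nat V
  set e : ℕ → V := fun n => f n.unpair.1 with he
  have hef : ∀ x N, ∃ m ≥ N, e m = x := by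
    intro x N
    obtain ⟨k, rfl⟩ := hf x
    exact ⟨Nat.pair k N, Nat.right_le_pair k N, by simp [he]⟩
  let W : Set V → Set V := fun T => maxWave (del G T) (A \ T) (B \ T)
  let T : ℕ → Set V := fun n => n.rec {a} fun n T =>
    T ∪ {x | x = e n ∧ x ∉ T ∧ x ∉ W T ∧ ∃ t ∈ T, G t x}
  have hT0 : T 0 = {a} := rfl
  have hTs : ∀ n, T (n + 1) = T n ∪ {x | x = e n ∧ x ∉ T n ∧ x ∉ W (T n) ∧ ∃ t ∈ T n, G t x} :=
    fun n => rfl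
  have hmono : Monotone T := monotone_nat_of_le_succ fun n => by
    rw [hTs]; exact Set.subset_union_left
  have haT : ∀ n, a ∈ T n := fun n => hmono (Nat.zero_le n) (by rw [hT0]; rfl)
  have hTA : ∀ n, ∀ x ∈ T n, x ∈ A → x = a := by
    intro n
    induction n with
    | zero => exact fun x hx _ => hx
    | succ n ih =>
      rw [hTs]
      rintro x (hx | ⟨-, h1, h2, -⟩) hxA
      · exact ih x hx hxA
      · exact absurd (subset_maxWave (show x ∈ A \ T n from ⟨hxA, h1⟩)) h2
  have hpath : ∀ n, ∀ x ∈ T n, ReflTransGen (res G (T n)) a x := by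
    intro n
    induction n with
    | zero => intro x hx; rw [show x = a from hx]
    | succ n ih =>
      have hle : ∀ x y, res G (T n) x y → res G (T (n + 1)) x y := fun x y h =>
        ⟨h.1, hmono (Nat.le_succ n) h.2.1, hmono (Nat.le_succ n) h.2.2⟩
      have hstep : ∀ x y, ReflTransGen (res G (T n)) x y → ReflTransGen (res G (T (n + 1))) x y :=
        ReflTransGen.mono hle
      intro x hx
      rw [hTs] at hx
      rcases hx with hx | hx
      · exact hstep _ _ (ih x hx)
      · obtain ⟨t, ht, htx⟩ := hx.2.2.2
        refine (hstep _ _ (ih t ht)).tail ⟨htx, hmono (Nat.le_succ n) ht, ?_⟩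
        rw [hTs]
        exact .inr hx
  have hunh : ∀ n, ¬ Hindered (del G (T n)) (A \ T n) (B \ T n) := by
    intro n
    induction n with
    | zero => rw [hT0]; exact not_hindered_del_source h ha
    | succ n ih =>
      rcases em (∃ x, x = e n ∧ x ∉ T n ∧ x ∉ W (T n) ∧ ∃ t ∈ T n, G t x) with hex | hex
      · obtain ⟨x, hx⟩ := hex
        have : T (n + 1) = T n ∪ {x} := by
          rw [hTs]
          congr 1
          ext y
          exact ⟨fun hy => hy.1.trans hx.1.symm, fun hy =>
            (Set.mem_singleton_iff.1 hy).symm ▸ hx⟩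
        rw [this, ← del_del, ← Set.sdiff_sdiff, ← Set.sdiff_sdiff]
        exact not_hindered_del ih hx.2.2.1
      · have : T (n + 1) = T n := by
          rw [hTs, Set.union_eq_left]
          exact fun y hy => (hex ⟨y, hy⟩).elim
        rwa [this]
  by_cases hB : ∃ n, (B ∩ T n).Nonempty
  · obtain ⟨n, b, hb⟩ := hB
    exact ⟨T n, haT n, hTA n, ⟨b, hb, hpath n b hb.2⟩, hunh n⟩
  exfalso
  have hWmono : Monotone fun n => W (T n) := monotone_nat_of_le_succ fun n x hx => by
    obtain ⟨C, hC, hxC⟩ := hx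
    refine ⟨C, Wave.del_of_disjoint (hmono (Nat.le_succ n)) hC ?_, hxC⟩
    rintro y ⟨hy, hyn⟩ hyC
    rw [hTs] at hy
    exact (hy.resolve_left hyn).2.2.1 ⟨C, hC, hyC⟩
  set U := ⋃ n, T n with hU
  have hmU : ∀ {x}, x ∈ U ↔ ∃ n, x ∈ T n := Set.mem_iUnion
  have hadd : ∀ m, ∀ y ∈ U, y ∉ T m → y ∉ W (T m) := by
    intro m y hy hym
    obtain ⟨n, hn⟩ := hmU.1 hy
    induction n with
    | zero => exact absurd (hmono (Nat.zero_le m) hn) hym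
    | succ n ih =>
      rw [hTs] at hn
      rcases hn with hn | hn
      · exact ih hn
      · have : m ≤ n := by
          by_contra hlt
          refine hym (hmono (show n + 1 ≤ m by omega) ?_)
          rw [hTs]; exact .inr hn
        exact fun h => hn.2.2.1 (hWmono this h)
  have hsucc : ∀ t ∈ U, ∀ x, G t x → x ∈ W U ∪ U := by
    intro t ht x htx
    by_cases hxU : x ∈ U
    · exact .inr hxU
    obtain ⟨n, hn⟩ := hmU.1 ht
    obtain ⟨m, hm, hmx⟩ := hef x n
    have hxW : x ∈ W (T m) := by
      by_contra hxW
      refine hxU (hmU.2 ⟨m + 1, ?_⟩)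
      rw [hTs]
      exact .inr ⟨hmx.symm, fun h => hxU (hmU.2 ⟨m, h⟩), hxW, t, hmono hm hn, htx⟩
    obtain ⟨C, hC, hxC⟩ := hxW
    refine .inl ⟨C, Wave.del_of_disjoint (fun y hy => hmU.2 ⟨m, hy⟩) hC ?_, hxC⟩
    exact fun y hy hyC => hadd m y hy.1 hy.2 ⟨C, hC, hyC⟩
  obtain ⟨hAW, M, hM⟩ := wave_maxWave (del G U) (A \ U) (B \ U)
  refine h ⟨W U ∪ U, a, ha, fun x hx => ?_, M, hM.mono ?_ ?_ ?_⟩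
  · by_cases hxU : x ∈ U
    · exact .inr hxU
    · exact .inl (hAW ⟨hx, hxU⟩)
  · exact fun x y _ h => ⟨h.1.1, .inl h.2.1, .inl h.2.2⟩
  · rintro x ⟨hx, hxU⟩
    refine ⟨hx, ?_⟩
    rintro rfl
    exact hxU (hmU.2 ⟨0, haT 0⟩)
  · rintro c ⟨hc, h⟩
    by_cases hcU : c ∈ U
    · rcases h with h | ⟨d, hd, hcd⟩
      · obtain ⟨n, hn⟩ := hmU.1 hcU
        exact absurd ⟨n, c, h, hn⟩ hB
      · exact absurd (hsucc c hcU d hcd) hd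
    · refine ⟨hc.resolve_right hcU, h.imp (fun h => ⟨h, hcU⟩) ?_⟩
      rintro ⟨d, hd, hcd⟩
      exact ⟨d, fun h => hd (.inl h), hcd, hcU, fun h => hd (.inr h)⟩

/-- Countable Menger theorem: an unhindered triple has a linkage of all of `A` into `B`. -/
theorem cov_swap_of_not_hindered [Countable V] {G : V → V → Prop} {A B : Set V}
    (h : ¬ Hindered G A B) : Cov (Function.swap G) B A := by
  rcases isEmpty_or_nonempty V with hV | hV
  · exact ⟨fun _ _ => False, fun x => hV.elim x, fun x => hV.elim x, fun x => hV.elim x,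
      fun x => hV.elim x, fun x => hV.elim x⟩
  obtain ⟨f, hf⟩ := exists_surjective_nat V
  let I := {S : Set V // ¬ Hindered (del G S) (A \ S) (B \ S)}
  have step : ∀ (S : I) (x : V), ∃ (T : I) (E : V → V → Prop),
      S.1 ⊆ T.1 ∧ (∀ u w, E u w → G u w ∧ u ∈ T.1 \ S.1 ∧ w ∈ T.1 \ S.1) ∧
      (∀ x y z, E x z → E y z → x = y) ∧ (∀ x y z, E x y → E x z → y = z) ∧
      (∀ a ∈ A, ∀ y, ¬ E y a) ∧ (∀ a ∈ A, a ∈ T.1 \ S.1 → ∃ b ∈ B, ReflTransGen E a b) ∧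
      (x ∈ A → x ∈ T.1) := by
    intro S x
    by_cases hx : x ∈ A \ S.1
    · obtain ⟨T, haT, hTA, ⟨b, hb, hab⟩, hT⟩ := exists_path_not_hindered S.2 hx
      obtain ⟨E, hE⟩ := exists_isLink_of_reflTransGen hab
      have hEA : ∀ a ∈ A, ∀ y, ¬ E y a := by
        intro a ha y hy
        have h1 := hE.sub hy
        have : a = x := hTA a h1.2.2 ⟨ha, h1.1.2.2⟩
        exact hE.noin (show a ∈ {x} from this) hy
      refine ⟨⟨S.1 ∪ T, ?_⟩, E, Set.subset_union_left, ?_, fun _ _ _ h1 h2 => hE.lu h1 h2,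
        fun _ _ _ h1 h2 => hE.ru h1 h2, hEA, ?_, fun _ => .inr haT⟩
      · rwa [← del_del, ← Set.sdiff_sdiff, ← Set.sdiff_sdiff]
      · intro u w huw
        have := hE.sub huw
        exact ⟨this.1.1, ⟨.inr this.2.1, this.1.2.1⟩, ⟨.inr this.2.2, this.1.2.2⟩⟩
      · rintro a ha ⟨haT, haS⟩
        have : a = x := hTA a (haT.resolve_left haS) ⟨ha, haS⟩
        subst this
        obtain ⟨c, hc, hac⟩ := hE.fwd (Set.mem_singleton a)
        rw [Set.mem_singleton_iff.1 hc] at hac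
        exact ⟨b, hb.1.1, hac⟩
    · refine ⟨S, fun _ _ => False, subset_rfl, fun _ _ h => h.elim, fun _ _ _ h => h.elim,
        fun _ _ _ h => h.elim, fun _ _ _ h => h, fun _ _ h => absurd h.1 h.2, fun h => ?_⟩
      by_contra hS
      exact hx ⟨h, hS⟩
  choose T E hST hET hlu hru hnoin hreach hmem using step
  let S₀ : I := ⟨∅, by
    have : del G ∅ = G := by ext; simp [del]
    rwa [this, Set.sdiff_empty, Set.sdiff_empty]⟩
  let S : ℕ → I := fun n => n.rec S₀ fun n s => T s (f n)
  have hSs : ∀ n, S (n + 1) = T (S n) (f n) := fun n => rfl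
  have hmono : Monotone fun n => (S n).1 := monotone_nat_of_le_succ fun n => by
    rw [hSs]; exact hST _ _
  have huniq : ∀ {n m x}, x ∈ (S (n + 1)).1 \ (S n).1 → x ∈ (S (m + 1)).1 \ (S m).1 → n = m := by
    intro n m x h1 h2
    by_contra hne
    rcases Nat.lt_or_gt_of_ne hne with hlt | hlt
    · exact h2.2 (hmono (show n + 1 ≤ m from hlt) h1.1)
    · exact h1.2 (hmono (show m + 1 ≤ n from hlt) h2.1)
  have hE' : ∀ n u w, E (S n) (f n) u w →
      G u w ∧ u ∈ (S (n + 1)).1 \ (S n).1 ∧ w ∈ (S (n + 1)).1 \ (S n).1 := fun n u w h =>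
    hET _ _ u w h
  refine ⟨fun x y => ∃ n, E (S n) (f n) y x, ?_, ?_, ?_, ?_, ?_⟩
  · rintro x y ⟨n, h⟩
    exact (hE' n _ _ h).1
  · rintro x y z ⟨n, h1⟩ ⟨m, h2⟩
    obtain rfl := huniq (hE' n _ _ h1).2.1 (hE' m _ _ h2).2.1
    exact hru _ _ _ _ _ h1 h2
  · rintro x y z ⟨n, h1⟩ ⟨m, h2⟩
    obtain rfl := huniq (hE' n _ _ h1).2.2 (hE' m _ _ h2).2.2
    exact hlu _ _ _ _ _ h1 h2
  · rintro x y hx ⟨n, h⟩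
    exact hnoin _ _ x hx y h
  · intro a ha
    have hex : ∃ n, a ∈ (S (n + 1)).1 \ (S n).1 := by
      obtain ⟨k, rfl⟩ := hf a
      have hk : f k ∈ (S (k + 1)).1 := hmem _ _ ha
      have : ∀ n, f k ∈ (S n).1 → ∃ n, f k ∈ (S (n + 1)).1 \ (S n).1 := by
        intro n
        induction n with
        | zero => exact fun h => h.elim
        | succ n ih =>
          intro h
          by_cases hn : f k ∈ (S n).1
          · exact ih hn
          · exact ⟨n, h, hn⟩
      exact this (k + 1) hk
    obtain ⟨n, hn⟩ := hex
    obtain ⟨b, hb, hab⟩ := hreach (S n) (f n) a ha hn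
    refine ⟨b, hb, ?_⟩
    have : ReflTransGen (Function.swap fun x y => ∃ n, E (S n) (f n) x y) b a :=
      reflTransGen_swap_iff.2 (ReflTransGen.mono (fun u w h => ⟨n, h⟩) _ _ hab)
    exact this

end Waves

section Bubbles
open Relation

theorem wave_of_augClosed {G M : V → V → Prop} {A A' B R X : Set V} {a : V}
    (h : IsLink G A X M) (hA : A ⊆ A') (hR : AugClosed G A M a R) (hB : ∀ u ∈ R, u ∉ B) :
    Wave G A' B (augSet G a R ∪ A') := by
  refine ⟨Set.subset_union_right, _, ((h.cov_of_augClosed hR).union_trivial (A' := A')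
    (fun x hx => hA hx.1) Set.subset_union_left).mono (fun _ _ _ h => h) subset_rfl ?_⟩
  rintro c ⟨hc, h⟩
  by_cases hcC : c ∈ augSet G a R
  · refine .inl (bd_augSet hB ⟨hcC, h.imp id ?_⟩)
    rintro ⟨d, hd, hcd⟩
    exact ⟨d, fun h => hd (.inl h), hcd⟩
  · exact .inr ⟨hc.resolve_left hcC, hcC⟩

/-- The set of `L`-successors of `v`. -/
def nb (L : V → V → Prop) (v : V) : Set V := {w | L v w}

/-- The largest set containing `v` whose boundary is linked to the `L`-successors of `v`. -/
def bub (L : V → V → Prop) (B : Set V) (v : V) : Set V :=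
  insert v (maxWave (del L {v}) (nb L v) (B \ {v}))

/-- The boundary of a set relative to the digraph with `v` removed. -/
def bdAt (L : V → V → Prop) (B : Set V) (v : V) (C : Set V) : Set V := bd (del L {v}) (B \ {v}) C

theorem mem_bub (L : V → V → Prop) (B : Set V) (v : V) : v ∈ bub L B v := .inl rfl

theorem ne_of_mem_bdAt {L : V → V → Prop} {B C : Set V} {v c : V} (h : c ∈ bdAt L B v C) :
    c ≠ v := by
  rintro rfl
  rcases h.2 with h | ⟨d, -, h⟩
  · exact h.2 rfl
  · exact h.2.1 rfl

theorem mem_bdAt {L : V → V → Prop} {B C : Set V} {v c : V} (hv : v ∈ C) (hc : c ∈ C) (hcv : c ≠ v)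
    (h : c ∈ B ∨ ∃ d, d ∉ C ∧ L c d) : c ∈ bdAt L B v C := by
  refine ⟨hc, h.imp (fun h => ⟨h, hcv⟩) ?_⟩
  rintro ⟨d, hd, h⟩
  exact ⟨d, hd, h, hcv, fun hdv => hd (Set.mem_singleton_iff.1 hdv ▸ hv)⟩

theorem of_mem_bdAt {L : V → V → Prop} {B C : Set V} {v c : V} (h : c ∈ bdAt L B v C) :
    c ∈ B ∨ ∃ d, d ∉ C ∧ L c d :=
  h.2.imp (fun h => h.1) fun ⟨d, hd, h⟩ => ⟨d, hd, h.1⟩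

theorem wave_bub (L : V → V → Prop) (B : Set V) (v : V) :
    Wave (del L {v}) (nb L v) (B \ {v}) (bub L B v) := by
  obtain ⟨h, M, hM⟩ := wave_maxWave (del L {v}) (nb L v) (B \ {v})
  refine ⟨fun x hx => .inr (h hx), M, hM.mono ?_ subset_rfl ?_⟩
  · exact fun x y _ h => ⟨h.1, .inr h.2.1, .inr h.2.2⟩
  · intro c hc
    have hcv : c ≠ v := ne_of_mem_bdAt hc
    refine ⟨hc.1.resolve_left hcv, hc.2.imp id ?_⟩
    rintro ⟨d, hd, hcd⟩
    exact ⟨d, fun h => hd (.inr h), hcd⟩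

theorem nb_subset_bub (L : V → V → Prop) (B : Set V) (v : V) : nb L v ⊆ bub L B v :=
  (wave_bub L B v).1

theorem Wave.subset_bub {L : V → V → Prop} {B C : Set V} {v : V}
    (h : Wave (del L {v}) (nb L v) (B \ {v}) C) : C ⊆ bub L B v :=
  h.subset_maxWave.trans (Set.subset_insert _ _)

theorem bub_subset_bub {L : V → V → Prop} {B : Set V} {y v : V} (hv : v ∈ bub L B y)
    (hvbd : v ∉ bdAt L B y (bub L B y)) : bub L B v ⊆ bub L B y := by
  by_cases hvy : v = y
  · rw [hvy]
  set C := bub L B y with hC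
  set C' := bub L B v with hC'
  obtain ⟨hNC, M, hM⟩ := wave_bub L B y
  obtain ⟨-, M', hM'⟩ := wave_bub L B v
  have hyC : y ∈ C := mem_bub L B y
  have hvB : v ∉ B := fun h => hvbd (mem_bdAt hyC hv hvy (.inl h))
  have hvN : ∀ w, L v w → w ∈ C := by
    intro w hw
    by_contra hwC
    exact hvbd (mem_bdAt hyC hv hvy (.inr ⟨w, hwC, hw⟩))
  have hM'' := hM'.mono (fun _ _ _ h => h) (fun w hw => hvN w hw) subset_rfl
  have hedge : ∀ u w, M' u w → w ∉ C → u ≠ y := by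
    rintro u w huw hw rfl
    exact hw (hNC (hM'.sub huw).1.1)
  refine Set.subset_union_right.trans (Wave.subset_bub (C := C ∪ C')
    ⟨fun x hx => .inl (hNC hx), _, (hM.ext (H := res (del L {y}) (C ∪ C')) (Z' := C ∩ bdAt L B y (C ∪ C'))
      (fun x y h => (hM.sub h).2) hM'' ?_ ?_ ?_ ?_ ?_).mono (fun _ _ _ h => h) subset_rfl ?_⟩)
  · intro u w h
    have := hM.sub h
    exact ⟨this.1, .inl this.2.1, .inl this.2.2⟩
  · intro u w h hw
    have := hM'.sub h
    refine ⟨⟨this.1.1, hedge u w h hw, ?_⟩, .inr this.2.1, .inr this.2.2⟩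
    rintro rfl
    exact hw hyC
  · intro u w h hu hw
    exact mem_bdAt hyC hu (hedge u w h hw) (.inr ⟨w, hw, (hM'.sub h).1.1⟩)
  · rintro c ⟨hc, h⟩
    refine mem_bdAt hyC hc (ne_of_mem_bdAt h) ((of_mem_bdAt h).imp id ?_)
    rintro ⟨d, hd, hcd⟩
    exact ⟨d, fun h => hd (.inl h), hcd⟩
  · rintro c ⟨hc, h⟩ w hcw
    by_contra hw
    have h1 := hM'.sub hcw
    refine hM'.out (mem_bdAt (mem_bub L B v) h1.2.1 h1.1.2.1 ((of_mem_bdAt h).imp id ?_)) hcw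
    rintro ⟨d, hd, hcd⟩
    exact ⟨d, fun h => hd (.inr h), hcd⟩
  · intro c hc
    by_cases hcC : c ∈ C
    · exact .inl ⟨hcC, hc⟩
    · refine .inr ⟨mem_bdAt (mem_bub L B v) (hc.1.resolve_left hcC) ?_ ((of_mem_bdAt hc).imp id ?_),
        hcC⟩
      · rintro rfl
        exact hcC hv
      · rintro ⟨d, hd, hcd⟩
        exact ⟨d, fun h => hd (.inr h), hcd⟩

/-- Every finite set of successors of every vertex is linked into `B`. -/
def Quasi (L : V → V → Prop) (B : Set V) : Prop :=
  ∀ v, ∀ J ⊆ nb L v, J.Finite → Cov (Function.swap (del L {v})) (B \ {v}) J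

theorem Cov.exists_isLink_swap {G : V → V → Prop} {A X : Set V} (h : Cov (Function.swap G) A X) :
    ∃ A' ⊆ A, ∃ M, IsLink G X A' M := by
  obtain ⟨M, hM⟩ := h
  obtain ⟨A', hA', M', -, hM', -⟩ := hM.exists_isLink
  exact ⟨A', hA', _, hM'.swap⟩

theorem IsLink.cov_swap {G M : V → V → Prop} {A X Y : Set V} (h : IsLink G A X M) (hX : X ⊆ Y) :
    Cov (Function.swap G) Y A := ⟨_, h.swap.toIsCov.mono (fun _ _ _ h => h) hX subset_rfl⟩

theorem exists_quasi (D : V → V → Prop) (hD : ∀ x, ¬ D x x) (B : Set V) :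
    ∃ Q : V → V → Prop, Q ≤ D ∧ Quasi Q B ∧ ∀ y, nb D y ⊆ bub Q B y := by
  obtain ⟨Q, ⟨hQD, hQ⟩, hmax⟩ := zorn_le₀ {L : V → V → Prop | L ≤ D ∧ Quasi L B} (by
    intro c hc hchain
    rcases c.eq_empty_or_nonempty with rfl | hne
    · refine ⟨fun _ _ => False, ⟨fun _ _ h => h.elim, fun v J hJ _ => ?_⟩, by simp⟩
      exact ⟨fun _ _ => False, fun _ _ h => h.elim, fun _ _ _ h => h.elim,
        fun _ _ _ h => h.elim, fun _ _ _ h => h, fun x hx => (hJ hx).elim⟩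
    · refine ⟨fun x y => ∃ L ∈ c, L x y, ⟨?_, ?_⟩, fun L hL x y h => ⟨L, hL, h⟩⟩
      · rintro x y ⟨L, hL, h⟩
        exact (hc hL).1 x y h
      · intro v J hJ hfin
        have : ∃ L ∈ c, J ⊆ nb L v := by
          induction J, hfin using Set.Finite.induction_on with
          | empty => exact ⟨hne.some, hne.some_mem, Set.empty_subset _⟩
          | insert hx hfin ih =>
            obtain ⟨L, hL, h⟩ := ih fun x hx => hJ (.inr hx)
            obtain ⟨L', hL', h'⟩ := hJ (.inl rfl)
            rcases hchain.total hL hL' with hle | hle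
            · exact ⟨L', hL', Set.insert_subset h' fun x hx => hle _ _ (h hx)⟩
            · exact ⟨L, hL, Set.insert_subset (hle _ _ h') h⟩
        obtain ⟨L, hL, h⟩ := this
        exact ((hc hL).2 v J h hfin).mono (fun x y h => ⟨⟨L, hL, h.1⟩, h.2⟩) subset_rfl subset_rfl)
  refine ⟨Q, hQD, hQ, fun y x hyx => ?_⟩
  by_contra hx
  have hxy : x ≠ y := by rintro rfl; exact hD x hyx
  have hQ' : Quasi (fun u w => Q u w ∨ (u = y ∧ w = x)) B := by
    intro v J hJ hfin
    by_cases hvy : v = y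
    · subst hvy
      have hJ' : J \ {x} ⊆ nb Q v := fun w hw => (hJ hw.1).resolve_right fun h => hw.2 h.2
      obtain ⟨X, hX, M, hM⟩ := (hQ v _ hJ' (hfin.subset Set.sdiff_subset)).exists_isLink_swap
      suffices Cov (Function.swap (del Q {v})) (B \ {v}) J from
        this.mono (fun x y h => ⟨.inl h.1, h.2⟩) subset_rfl subset_rfl
      by_cases hxJ : x ∈ J
      · obtain ⟨R, hR, -, hs⟩ := hM.augment (a := x) (by simp)
        by_cases hb : ∃ b ∈ R, b ∈ B \ {v}
        · obtain ⟨b, hbR, hb⟩ := hb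
          obtain ⟨M', hM'⟩ := hs b hbR
          rw [Set.insert_sdiff_singleton, Set.insert_eq_of_mem hxJ] at hM'
          exact hM'.cov_swap (Set.insert_subset hb hX)
        · push Not at hb
          exact absurd ((wave_of_augClosed hM hJ' hR hb).subset_bub (.inl (.inl rfl))) hx
      · rw [Set.sdiff_singleton_eq_self hxJ] at hM
        exact hM.cov_swap hX
    · exact (hQ v J (fun w hw => (hJ hw).resolve_right fun h => hvy h.1) hfin).mono
        (fun x y h => ⟨.inl h.1, h.2⟩) subset_rfl subset_rfl
  have hle := hmax (y := fun u w => Q u w ∨ (u = y ∧ w = x)) ⟨?_, hQ'⟩ fun u w h => .inl h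
  · exact hx (nb_subset_bub Q B y (hle y x (.inr ⟨rfl, rfl⟩)))
  · rintro u w (h | ⟨rfl, rfl⟩)
    · exact hQD _ _ h
    · exact hyx

/-- Cutting a linkage at the boundary `S` of `C`. -/
theorem Cov.cut {G : V → V → Prop} {A C J S : Set V} (h : Cov (Function.swap G) A J)
    (hC : ∀ u ∈ C, u ∉ S → ∀ w, G u w → w ∈ C) (hA : ∀ u ∈ C, u ∈ A → u ∈ S) (hJ : J ⊆ C) :
    Cov (Function.swap (res G C)) S J := by
  obtain ⟨A', hA', M, hM⟩ := h.exists_isLink_swap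
  refine ⟨fun w u => M u w ∧ u ∈ C ∧ u ∉ S, ?_, ?_, ?_, ?_, ?_⟩
  · rintro w u ⟨h, hu, huS⟩
    exact ⟨hM.sub h, hu, hC u hu huS w (hM.sub h)⟩
  · exact fun x y z h1 h2 => hM.ru h1.1 h2.1
  · exact fun x y z h1 h2 => hM.lu h1.1 h2.1
  · exact fun x y hx h => hM.noin hx h.1
  · intro j hj
    obtain ⟨x, hx, hjx⟩ := hM.fwd hj
    have key : j ∈ C → ∃ y ∈ S, ReflTransGen (fun u w => M u w ∧ u ∈ C ∧ u ∉ S) j y := by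
      clear hj
      induction hjx using ReflTransGen.head_induction_on with
      | refl => exact fun h => ⟨x, hA x h (hA' hx), .refl⟩
      | head h1 h2 ih =>
        rename_i c d
        intro hc
        by_cases hcS : c ∈ S
        · exact ⟨c, hcS, .refl⟩
        · obtain ⟨y, hy, hdy⟩ := ih (hC c hc hcS d (hM.sub h1))
          exact ⟨y, hy, .head ⟨h1, hc, hcS⟩ hdy⟩
    obtain ⟨y, hy, hjy⟩ := key (hJ hj)
    exact ⟨y, hy, reflTransGen_swap_iff.2 hjy⟩

/-- Joining the path ending in `b` to the path starting in `o`. -/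
theorem IsLink.join {G M : V → V → Prop} {A X : Set V} {b o : V} (h : IsLink G A (insert b X) M)
    (hb : b ∉ X) (ho : o ∈ A) (hob : ¬ ReflTransGen M o b) (hbo : G b o) :
    ∃ M', IsLink G (A \ {o}) X M' := by
  set M' : V → V → Prop := fun x y => M x y ∨ (x = b ∧ y = o) with hM'
  have hmono : ∀ x y, ReflTransGen M x y → ReflTransGen M' x y := fun x y h =>
    ReflTransGen.mono (fun _ _ h => .inl h) _ _ h
  obtain ⟨s, hs, hsb⟩ := h.reach (Set.mem_insert b X)
  have hso : s ∈ A \ {o} := ⟨hs, by rintro rfl; exact hob hsb⟩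
  have hso' : ReflTransGen M' s o := (hmono _ _ hsb).tail (.inr ⟨rfl, rfl⟩)
  obtain ⟨z, hz, hoz⟩ := h.fwd ho
  have hzX : z ∈ X := hz.resolve_left (by rintro rfl; exact hob hoz)
  have hbz : ReflTransGen M' b z := .head (.inr ⟨rfl, rfl⟩) (hmono _ _ hoz)
  have hsrc : ∀ x, (∃ a ∈ A, ReflTransGen M a x) → ∃ a ∈ A \ {o}, ReflTransGen M' a x := by
    rintro x ⟨a, ha, hax⟩
    by_cases hao : a = o
    · subst hao
      exact ⟨s, hso, hso'.trans (hmono _ _ hax)⟩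
    · exact ⟨a, ⟨ha, hao⟩, hmono _ _ hax⟩
  have htgt : ∀ y, (∃ x ∈ insert b X, ReflTransGen M y x) → ∃ x ∈ X, ReflTransGen M' y x := by
    rintro y ⟨x, rfl | hx, hyx⟩
    · exact ⟨z, hzX, (hmono _ _ hyx).trans hbz⟩
    · exact ⟨x, hx, hmono _ _ hyx⟩
  refine ⟨M', ⟨?_, ?_, ?_, ?_, fun x hx => hsrc x (h.reach (.inr hx))⟩, ?_,
    fun a ha => htgt a (h.fwd ha.1), ?_, ?_⟩
  · rintro x y (hxy | ⟨rfl, rfl⟩)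
    · exact h.sub hxy
    · exact hbo
  · rintro x y z (h1 | ⟨rfl, rfl⟩) (h2 | ⟨rfl, h2⟩)
    · exact h.lu h1 h2
    · exact absurd h1 (h.noin (h2 ▸ ho))
    · exact absurd h2 (h.noin ho)
    · rfl
  · rintro x y z (h1 | ⟨rfl, rfl⟩) (h2 | ⟨h2, rfl⟩)
    · exact h.ru h1 h2
    · exact absurd h1 (h.out (.inl h2))
    · exact absurd h2 (h.out (.inl rfl))
    · rfl
  · rintro x y hx (h1 | ⟨rfl, rfl⟩)
    · exact h.out (.inr hx) h1
    · exact hb hx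
  · rintro x y hx (h1 | ⟨rfl, rfl⟩)
    · exact h.noin hx.1 h1
    · exact hx.2 rfl
  · rintro x y (h1 | ⟨rfl, rfl⟩)
    · exact hsrc x (h.src h1)
    · exact hsrc x ⟨s, hs, hsb⟩
  · rintro x y (h1 | ⟨rfl, rfl⟩)
    · exact htgt y (h.tgt h1)
    · exact htgt y ⟨z, hz, hoz⟩

/-- A linkage from a subset of `N` onto `Y` can be changed so that it uses a given finite
linkable subset of `N`. -/
theorem exchange {G : V → V → Prop} {N Y J : Set V} (h : Cov G N Y) (hJ : J.Finite) (hJN : J ⊆ N)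
    (hJY : Cov (Function.swap G) Y J) : ∃ T, J ⊆ T ∧ T ⊆ N ∧ ∃ M, IsLink G T Y M := by
  induction J, hJ using Set.Finite.induction_on with
  | empty =>
    obtain ⟨M, hM⟩ := h
    obtain ⟨T, hT, M', -, hM', -⟩ := hM.exists_isLink
    exact ⟨T, Set.empty_subset _, hT, M', hM'⟩
  | insert hj hfin ih =>
    rename_i j J
    obtain ⟨T, hJT, hTN, M, hM⟩ := ih (fun x hx => hJN (.inr hx))
      (hJY.mono (fun _ _ h => h) subset_rfl (Set.subset_insert _ _))
    by_cases hjT : j ∈ T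
    · exact ⟨T, Set.insert_subset hjT hJT, hTN, M, hM⟩
    suffices ∃ o ∈ T, o ∉ J ∧ ∃ M', IsLink G (insert j T \ {o}) Y M' by
      obtain ⟨o, hoT, hoJ, M', hM'⟩ := this
      refine ⟨insert j T \ {o}, ?_, ?_, M', hM'⟩
      · rintro x (rfl | hx)
        · exact ⟨.inl rfl, by rintro rfl; exact hjT hoT⟩
        · exact ⟨.inr (hJT hx), by rintro rfl; exact hoJ hx⟩
      · rintro x ⟨rfl | hx, -⟩
        · exact hJN (.inl rfl)
        · exact hTN hx
    obtain ⟨R, hR, hRY, hs⟩ := hM.augment hjT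
    have herase : ∀ {b o M'}, b ∈ R → o ∈ T → IsLink G (insert j T) (insert b Y) M' →
        ReflTransGen M' o b → ∃ M', IsLink G (insert j T \ {o}) Y M' := by
      intro b o M' hb ho hM' hob
      have := hM'.erase (.inr ho) (.inl rfl) hob
      rw [Set.insert_sdiff_of_mem _ (Set.mem_singleton b),
        Set.sdiff_singleton_eq_self (hRY b hb)] at this
      exact ⟨_, this⟩
    by_cases hs1 : ∃ b ∈ R, b ∈ T ∧ b ∉ J
    · obtain ⟨b, hb, hbT, hbJ⟩ := hs1
      obtain ⟨M', hM'⟩ := hs b hb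
      exact ⟨b, hbT, hbJ, herase hb hbT hM' .refl⟩
    by_cases hs2 : ∃ b ∈ R, ∃ o ∈ T, o ∉ J ∧ G b o
    · obtain ⟨b, hb, o, hoT, hoJ, hbo⟩ := hs2
      obtain ⟨M', hM'⟩ := hs b hb
      refine ⟨o, hoT, hoJ, ?_⟩
      by_cases hob : ReflTransGen M' o b
      · exact herase hb hoT hM' hob
      · exact hM'.join (hRY b hb) (.inr hoT) hob hbo
    exfalso
    set C := augSet G j R with hC
    have hTC : T ∩ C ⊆ J := by
      rintro w ⟨hwT, hwC⟩
      by_contra hwJ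
      rcases hwC with rfl | hw | ⟨u, hu, huw⟩
      · exact hjT hwT
      · exact hs1 ⟨w, hw, hwT, hwJ⟩
      · exact hs2 ⟨u, hu, w, hwT, hwJ, huw⟩
    obtain ⟨T', hT', M₁, -, hM₁, -⟩ := (hM.cov_of_augClosed hR).exists_isLink
    have hcut : Cov (Function.swap (res G C)) (C \ R) (insert j (T ∩ C)) := by
      refine (hJY.mono (fun _ _ h => h) subset_rfl (Set.insert_subset_insert hTC)).cut ?_ ?_ ?_
      · intro u hu huS w huw
        by_cases huR : u ∈ R
        · exact augSet_succ huR huw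
        · exact absurd ⟨hu, huR⟩ huS
      · exact fun u hu huY => ⟨hu, fun h => hRY u h huY⟩
      · exact Set.insert_subset (.inl rfl) Set.inter_subset_right
    obtain ⟨S, hS, M₂, hM₂⟩ := hcut.exists_isLink_swap
    have h1 : (insert j (T ∩ C)).encard ≤ (T ∩ C).encard := by
      rw [hM₂.encard_eq]
      exact (Set.encard_le_encard hS).trans (hM₁.encard_eq ▸ Set.encard_le_encard hT')
    have hf : (T ∩ C).Finite := hfin.subset hTC
    rw [Set.encard_insert_of_notMem fun h => hjT h.1] at h1
    exact absurd h1 (not_le.2 (ENat.lt_add_one_iff (Set.encard_ne_top_iff.2 hf) |>.2 le_rfl))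

end Bubbles

section Cutting
open Relation

/-- The boundary of `bub L B v` is linked into `B` outside of `bub L B v`. -/
theorem exists_isLink_bdAt_bub [Countable V] (L : V → V → Prop) (B : Set V) (v : V) :
    ∃ X ⊆ B \ {v}, ∃ M, IsLink (del (del L {v}) (bub L B v \ bdAt L B v (bub L B v)))
      (bdAt L B v (bub L B v)) X M := by
  set C := bub L B v with hC
  set Y := bdAt L B v C with hY
  set K := del (del L {v}) (C \ Y) with hK
  refine (cov_swap_of_not_hindered ?_).exists_isLink_swap
  rintro ⟨C', y, hy, hYC, M', hM'⟩
  obtain ⟨hNC, M, hM⟩ := wave_bub L B v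
  have hwave : Wave (del L {v}) (nb L v) (B \ {v}) (C ∪ C') := by
    refine ⟨hNC.trans Set.subset_union_left, _, (IsCov.ext (C := C)
      (H := res (del L {v}) (C ∪ C')) (Z' := {x ∈ Y | ∀ y, M' x y → y ∈ C})
      hM (fun x y h => (hM.sub h).2)
      (hM'.mono (A' := C) (fun _ _ _ h => h) ?_ subset_rfl) ?_ ?_ ?_ ?_ ?_).mono
        (fun _ _ _ h => h) subset_rfl ?_⟩
    · exact fun x hx => hx.1.1
    · exact fun x y h => ⟨(hM.sub h).1, .inl (hM.sub h).2.1, .inl (hM.sub h).2.2⟩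
    · exact fun x y h _ => ⟨(hM'.sub h).1.1, .inr (hM'.sub h).2.1, .inr (hM'.sub h).2.2⟩
    · exact fun x y h hx _ => by_contra fun hxY => (hM'.sub h).1.2.1 ⟨hx, hxY⟩
    · exact fun x hx => hx.1
    · exact fun x hx => hx.2
    · rintro c ⟨hc, h⟩
      have hX : c ∈ C' → (c ∈ C → c ∈ Y) → c ∈ bd K (B \ {v}) C' := by
        refine fun hc' hcY => ⟨hc', h.imp id ?_⟩
        rintro ⟨d, hd, hcd⟩
        exact ⟨d, fun h => hd (.inr h), hcd, fun h => h.2 (hcY h.1), fun h => hd (.inl h.1)⟩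
      by_cases hcC : c ∈ C
      · have hcY : c ∈ Y := by
          refine ⟨hcC, h.imp id ?_⟩
          rintro ⟨d, hd, hcd⟩
          exact ⟨d, fun h => hd (.inl h), hcd⟩
        exact .inl ⟨hcY, fun z hz => absurd hz (hM'.out (hX (hYC hcY) fun _ => hcY))⟩
      · exact .inr ⟨hX (hc.resolve_left hcC) fun h => absurd h hcC, hcC⟩
  have hC' : C' ⊆ C := fun x hx => hwave.subset_bub (.inr hx)
  have hYX : ∀ x ∈ Y, x ∈ bd K (B \ {v}) C' := by
    refine fun x hx => ⟨hYC hx, hx.2.imp id ?_⟩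
    rintro ⟨d, hd, hcd⟩
    exact ⟨d, fun h => hd (hC' h), hcd, fun h => h.2 hx, fun h => hd h.1⟩
  obtain ⟨a, ha, hay⟩ := hM'.reach (hYX y hy)
  exact ha.2 (eq_of_reflTransGen_of_no_out hay fun z => hM'.out (hYX a ha.1)).symm

theorem Quasi.exists_isLink_bub {L : V → V → Prop} {B J : Set V} {v : V} (h : Quasi L B)
    (hJ : J ⊆ nb L v) (hJf : J.Finite) : ∃ T, J ⊆ T ∧ T ⊆ nb L v ∧
      ∃ M, IsLink (res (del L {v}) (bub L B v)) T (bdAt L B v (bub L B v)) M := by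
  refine exchange (wave_bub L B v).2 hJf hJ ((h v J hJ hJf).cut ?_ ?_
    (hJ.trans (nb_subset_bub L B v)))
  · exact fun u hu huY w huw => by_contra fun hw => huY ⟨hu, .inr ⟨w, hw, huw⟩⟩
  · exact fun u hu huB => ⟨hu, .inl huB⟩

theorem IsLink.concat {G G₁ G₂ M₁ M₂ : V → V → Prop} {T X Y C : Set V} (h₁ : IsLink G₁ T Y M₁)
    (h₂ : IsLink G₂ Y X M₂) (hG₁ : ∀ x y, M₁ x y → G x y) (hG₂ : ∀ x y, M₂ x y → G x y)
    (hM₁ : ∀ x y, M₁ x y → x ∈ C ∧ y ∈ C) (hM₂ : ∀ x y, M₂ x y → (x ∈ C → x ∈ Y) ∧ (y ∈ C → y ∈ Y))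
    (hT : T ⊆ C) (hX : ∀ x ∈ X, x ∈ C → x ∈ Y) : IsLink G T X (fun x y => M₁ x y ∨ M₂ x y) := by
  have hC : ∀ x y, M₂ x y → y ∉ C := fun x y h hy => h₂.noin ((hM₂ x y h).2 hy) h
  have m₁ : ∀ {x y}, ReflTransGen M₁ x y → ReflTransGen (fun x y => M₁ x y ∨ M₂ x y) x y :=
    fun h => ReflTransGen.mono (fun _ _ h => .inl h) _ _ h
  have m₂ : ∀ {x y}, ReflTransGen M₂ x y → ReflTransGen (fun x y => M₁ x y ∨ M₂ x y) x y :=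
    fun h => ReflTransGen.mono (fun _ _ h => .inr h) _ _ h
  have hsrc : ∀ {x y}, y ∈ Y → ReflTransGen M₂ y x →
      ∃ a ∈ T, ReflTransGen (fun x y => M₁ x y ∨ M₂ x y) a x := fun hy h =>
    let ⟨a, ha, h'⟩ := h₁.reach hy
    ⟨a, ha, (m₁ h').trans (m₂ h)⟩
  have htgt : ∀ {x y}, y ∈ Y → ReflTransGen M₁ x y →
      ∃ z ∈ X, ReflTransGen (fun x y => M₁ x y ∨ M₂ x y) x z := fun hy h =>
    let ⟨z, hz, h'⟩ := h₂.fwd hy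
    ⟨z, hz, (m₁ h).trans (m₂ h')⟩
  refine ⟨⟨fun x y h => h.elim (hG₁ x y) (hG₂ x y), ?_, ?_, ?_, ?_⟩, ?_, ?_, ?_, ?_⟩
  · rintro x y z (h | h) (h' | h')
    · exact h₁.lu h h'
    · exact absurd (hM₁ _ _ h).2 (hC _ _ h')
    · exact absurd (hM₁ _ _ h').2 (hC _ _ h)
    · exact h₂.lu h h'
  · rintro x y z (h | h) (h' | h')
    · exact h₁.ru h h'
    · exact absurd h (h₁.out ((hM₂ _ _ h').1 (hM₁ _ _ h).1))
    · exact absurd h' (h₁.out ((hM₂ _ _ h).1 (hM₁ _ _ h').1))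
    · exact h₂.ru h h'
  · rintro x y hx (h | h)
    · exact h₁.out (hX x hx (hM₁ _ _ h).1) h
    · exact h₂.out hx h
  · intro x hx
    obtain ⟨y, hy, h⟩ := h₂.reach hx
    exact hsrc hy h
  · rintro a y ha (h | h)
    · exact h₁.noin ha h
    · exact hC _ _ h (hT ha)
  · intro a ha
    obtain ⟨y, hy, h⟩ := h₁.fwd ha
    exact htgt hy h
  · rintro x y (h | h)
    · obtain ⟨a, ha, h'⟩ := h₁.src h
      exact ⟨a, ha, m₁ h'⟩
    · obtain ⟨a, ha, h'⟩ := h₂.src h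
      exact hsrc ha h'
  · rintro x y (h | h)
    · obtain ⟨a, ha, h'⟩ := h₁.tgt h
      exact htgt ha h'
    · obtain ⟨a, ha, h'⟩ := h₂.tgt h
      exact ⟨a, ha, m₂ h'⟩

/-- Paths of `G` using the vertex `v` may be rerouted in the smaller digraph `G'` if the
`G'`-successors of `v` are linked to the boundary of a set containing all `G`-successors. -/
theorem Cov.repair {G G' Mv : V → V → Prop} {A X Z C : Set V} {v y : V} (h : Cov (del G {y}) A X)
    (hG : ∀ x w, G x w → x ≠ v → G' x w) (hyv : y ≠ v)
    (hvG : ∀ w, G v w → w ∈ C) (hMv : IsCov (res G' C) {w | G' v w} Z Mv)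
    (hMvv : ∀ x w, Mv x w → x ≠ v) (hZ₁ : ∀ c ∈ C, c ≠ v → ∀ d, G c d → d ∉ C → c ∈ Z)
    (hZ₂ : ∀ c ∈ X, c ∈ C → c ≠ v → c ∈ Z) (hA : ∀ w, Mv y w → w ∈ A) (hyX : y ∉ X) :
    Cov (del G' {y}) A X := by
  obtain ⟨M, hM⟩ := h
  obtain ⟨A₁, hA₁, M, -, hM, -⟩ := hM.exists_isLink
  by_cases hv : ∃ w, M v w
  swap
  · exact ⟨M, hM.toIsCov.mono (fun x w hxw h => ⟨hG x w h.1 fun hx => hv ⟨w, hx ▸ hxw⟩, h.2⟩)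
      hA₁ subset_rfl⟩
  obtain ⟨w₀, hw₀⟩ := hv
  obtain ⟨a, ha, hav⟩ := hM.src hw₀
  obtain ⟨x₀, hx₀, hwx⟩ := hM.tgt hw₀
  have hax : ReflTransGen M a x₀ := hav.trans (.head hw₀ hwx)
  set N : V → V → Prop := fun u w => M u w ∧ ¬ ReflTransGen M w x₀ with hN
  set H := del G' {y} with hH
  have hNl : IsLink H (A₁ \ {a}) (X \ {x₀}) N := by
    refine (hM.erase ha hx₀ hax).mono fun x w hxw h => ⟨hG x w h.1 ?_, h.2⟩
    rintro rfl
    exact hxw.2 (hM.ru hw₀ hxw.1 ▸ hwx)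
  obtain ⟨R, hR, hRX, hRM⟩ := hNl.augment (a := a) fun h => h.2 rfl
  by_cases hx₀R : x₀ ∈ R
  · obtain ⟨M', hM'⟩ := hRM x₀ hx₀R
    rw [Set.insert_sdiff_singleton, Set.insert_sdiff_singleton, Set.insert_eq_of_mem ha,
      Set.insert_eq_of_mem hx₀] at hM'
    exact ⟨M', hM'.toIsCov.mono (fun _ _ _ h => h) hA₁ subset_rfl⟩
  have hRX' : ∀ u ∈ R, u ∉ X := fun u hu huX => hRX u hu ⟨huX, fun h => hx₀R (h ▸ hu)⟩
  have hwalk : ∀ u, ReflTransGen M a u → u ∈ R ∨ v ∈ R := by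
    intro u hu
    induction hu with
    | refl => exact .inl ((hR a (fun h => h.2 rfl) (.inl rfl)).2 fun z hz => hM.noin ha hz.1)
    | tail h1 h2 ih =>
      rename_i b c
      rcases ih with hb | hvR
      · by_cases hbv : b = v
        · exact .inr (hbv ▸ hb)
        · have hbc := hM.sub h2
          exact .inl ((hR c (fun h => hM.noin h.1 h2)
            (.inr ⟨b, hb, .inr ⟨hG b c hbc.1 hbv, hbc.2⟩⟩)).2
            fun z hz => hz.2 (hM.before_target hx₀ hax (h1.tail h2)))
      · exact .inr hvR
  have hvR : v ∈ R := (hwalk v hav).elim id id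
  set C₀ := augSet H a R with hC₀
  set E₁ := insert y (C₀ ∪ A) with hE₁
  have hcov := (hNl.cov_of_augClosed hR).union_trivial (A' := A) (C' := E₁)
    (fun x hx => hA₁ hx.1.1) (fun x hx => .inr (.inl hx))
  set M₀ : V → V → Prop := fun u w => N u w ∧ w ∈ augSet H a R with hM₀
  set Z₁ := C₀ \ R ∪ A \ C₀ with hZ₁def
  set Z₂ := {z ∈ Z₁ | z ≠ y ∧ (z ∈ X ∨ ∃ d, d ∉ C ∧ G z d)} with hZ₂def
  have hMvE : ∀ x w, Mv x w → w ∉ E₁ → x ≠ y ∧ w ≠ y := by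
    refine fun x w hxw hw => ⟨?_, fun h => hw (.inl h)⟩
    rintro rfl
    exact hw (.inr (.inr (hA w hxw)))
  have hZ₁mem : ∀ x ∈ E₁, x ≠ y → x ∉ R → x ∈ Z₁ := by
    rintro x (hx | hx | hx) hxy hxR
    · exact absurd hx hxy
    · exact .inl ⟨hx, hxR⟩
    · by_cases hx' : x ∈ C₀
      · exact .inl ⟨hx', hxR⟩
      · exact .inr ⟨hx, hx'⟩
  have hRout : ∀ x w, G' x w → x ≠ y → w ∉ E₁ → x ∉ R := fun x w hxw hxy hw hxR =>
    hw (.inr (.inl (augSet_succ hxR ⟨hxw, hxy, fun h => hw (.inl h)⟩)))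
  have hcov₁ : IsCov H A (Z₂ ∪ Z \ E₁) (fun x w => M₀ x w ∨ (Mv x w ∧ w ∉ E₁)) := by
    refine hcov.ext (G' := res G' C) (fun x w h => (hcov.sub h).2)
      (hMv.mono (fun _ _ _ h => h) ?_ subset_rfl)
      (fun x w h => (hcov.sub h).1) ?_ ?_ (fun x hx => hx.1) ?_
    · intro w hw
      by_cases hwy : w = y
      · exact .inl hwy
      · exact .inr (.inl (augSet_succ hvR ⟨hw, Ne.symm hyv, hwy⟩))
    · exact fun x w hxw hw => ⟨(hMv.sub hxw).1, hMvE x w hxw hw⟩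
    · exact fun x w hxw hx hw => hZ₁mem x hx (hMvE x w hxw hw).1
        (hRout x w (hMv.sub hxw).1 (hMvE x w hxw hw).1 hw)
    · rintro x ⟨hx, hxy, hxX⟩ w hxw
      exfalso
      have hxC := (hMv.sub hxw).2.1
      refine hMv.out ?_ hxw
      rcases hxX with hxX | ⟨d, hd, hxd⟩
      · exact hZ₂ x hxX hxC (hMvv x w hxw)
      · exact hZ₁ x hxC (hMvv x w hxw) d hxd hd
  have hcov₂ := hcov₁.ext (C := E₁ ∪ C) (G' := del G {y}) (H := H) (X := X) (M' := M)
    (Z' := X ∩ (E₁ ∪ C)) ?_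
    (hM.toIsCov.mono (fun _ _ _ h => h) (fun x hx => .inl (.inr (.inr (hA₁ hx)))) subset_rfl)
    (fun x w h => hcov₁.sub h) ?_ ?_ ?_ (fun x hx w hxw => absurd hxw (hM.out hx.1))
  · exact ⟨_, hcov₂.mono (fun _ _ _ h => h) subset_rfl fun x hx => by
      by_cases h : x ∈ E₁ ∪ C
      · exact .inl ⟨hx, h⟩
      · exact .inr ⟨hx, h⟩⟩
  · rintro x w (h | h)
    · exact ⟨.inl (hcov.sub h).2.1, .inl (hcov.sub h).2.2⟩
    · exact ⟨.inr (hMv.sub h.1).2.1, .inr (hMv.sub h.1).2.2⟩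
  · intro x w hxw hw
    refine ⟨hG x w (hM.sub hxw).1 ?_, (hM.sub hxw).2⟩
    rintro rfl
    exact hw (.inr (hvG w (hM.sub hxw).1))
  · intro x w hxw hx hw
    obtain ⟨hxw, hxy, -⟩ := hM.sub hxw
    have hxv : x ≠ v := by
      rintro rfl
      exact hw (.inr (hvG w hxw))
    by_cases hxE : x ∈ E₁
    · exact .inl ⟨hZ₁mem x hxE hxy (hRout x w (hG x w hxw hxv) hxy fun h => hw (.inl h)), hxy,
        .inr ⟨w, fun h => hw (.inr h), hxw⟩⟩
    · exact .inr ⟨hZ₁ x (hx.resolve_left hxE) hxv w hxw fun h => hw (.inr h), hxE⟩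
  · rintro x ⟨hxX, hx⟩
    have hxy : x ≠ y := fun h => hyX (h ▸ hxX)
    have hxR : x ∉ R := fun h => hRX' x h hxX
    by_cases hxE : x ∈ E₁
    · exact .inl ⟨hZ₁mem x hxE hxy hxR, hxy, .inl hxX⟩
    · exact .inr ⟨hZ₂ x hxX (hx.resolve_left hxE) (fun h => hxR (h ▸ hvR)), hxE⟩

/-- Restricting the successors of `v` to `T`. -/
def cut (L : V → V → Prop) (v : V) (T : Set V) : V → V → Prop := fun x y => L x y ∧ (x = v → y ∈ T)

theorem del_cut (L : V → V → Prop) (v : V) (T : Set V) : del (cut L v T) {v} = del L {v} := by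
  ext x y
  simp only [del, cut, Set.mem_singleton_iff]
  tauto

theorem nb_cut {L : V → V → Prop} {v : V} {T : Set V} (hT : T ⊆ nb L v) : nb (cut L v T) v = T := by
  ext x
  exact ⟨fun h => h.2 rfl, fun h => ⟨hT h, fun _ => h⟩⟩

theorem bub_subset_bub_cut {L M : V → V → Prop} {B T : Set V} {v : V} (hT : T ⊆ nb L v)
    (hM : IsLink (res (del L {v}) (bub L B v)) T (bdAt L B v (bub L B v)) M) (y : V) :
    bub L B y ⊆ bub (cut L v T) B y := by
  refine Wave.subset_bub ?_
  by_cases hyv : y = v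
  · subst hyv
    rw [del_cut, nb_cut hT]
    exact ⟨hT.trans (nb_subset_bub L B y), M, hM.toIsCov⟩
  obtain ⟨hNC, hcov⟩ := wave_bub L B y
  have hnb : nb (cut L v T) y = nb L y := by
    ext x
    exact ⟨fun h => h.1, fun h => ⟨h, fun h => absurd h hyv⟩⟩
  rw [hnb]
  refine ⟨hNC, Cov.mono (A := nb L y) (X := bdAt L B y (bub L B y))
    (G := res (del (cut L v T) {y}) (bub L B y)) ?_ (fun _ _ h => h) subset_rfl ?_⟩
  swap
  · rintro c ⟨hc, h⟩
    refine ⟨hc, h.imp id ?_⟩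
    rintro ⟨d, hd, hcd⟩
    exact ⟨d, hd, hcd.1.1, hcd.2⟩
  by_cases hv : v ∈ bub L B y ∧ v ∉ bdAt L B y (bub L B y)
  · have hsub := bub_subset_bub hv.1 hv.2
    have := Cov.repair (G := res L (bub L B y)) (G' := res (cut L v T) (bub L B y)) (Mv := M)
      (A := nb L y) (X := bdAt L B y (bub L B y)) (Z := bdAt L B v (bub L B v)) (C := bub L B v)
      (v := v) (y := y) (hcov.mono (fun x w h => ⟨⟨h.1.1, h.2⟩, h.1.2⟩) subset_rfl subset_rfl)
      (fun x w h hx => ⟨⟨h.1, fun h => absurd h hx⟩, h.2⟩) hyv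
      (fun w h => nb_subset_bub L B v h.1)
      (hM.toIsCov.mono (fun x w _ h => ⟨⟨⟨h.1.1, fun h' => absurd h' h.1.2.1⟩, hsub h.2.1,
        hsub h.2.2⟩, h.2⟩) (fun w hw => ⟨⟨hT hw, fun _ => hw⟩, hv.1,
          hsub (nb_subset_bub L B v (hT hw))⟩) subset_rfl)
      (fun x w h => (hM.sub h).1.2.1)
      (fun c hc hcv d hcd hd => mem_bdAt (mem_bub L B v) hc hcv (.inr ⟨d, hd, hcd.1⟩))
      (fun c hcX hc hcv => mem_bdAt (mem_bub L B v) hc hcv ((of_mem_bdAt hcX).imp id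
        fun ⟨d, hd, hcd⟩ => ⟨d, fun h => hd (hsub h), hcd⟩))
      (fun w h => (hM.sub h).1.1) (fun h => ne_of_mem_bdAt h rfl)
    exact this.mono (fun x w h => ⟨⟨h.1.1, h.2⟩, h.1.2⟩) subset_rfl subset_rfl
  · obtain ⟨N, hN⟩ := hcov
    refine ⟨N, hN.mono (fun x w hxw h => ⟨⟨⟨h.1.1, ?_⟩, h.1.2⟩, h.2⟩) subset_rfl subset_rfl⟩
    rintro rfl
    exact absurd hxw (hN.out (by_contra fun hx => hv ⟨h.2.1, hx⟩))

theorem Quasi.cut {L M : V → V → Prop} {B T : Set V} {v : V} (h : Quasi L B) (hT : T ⊆ nb L v)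
    (hM : IsLink (res (del L {v}) (bub L B v)) T (bdAt L B v (bub L B v)) M) :
    Quasi (cut L v T) B := by
  intro w J hJ hJf
  by_cases hwv : w = v
  · subst hwv
    rw [del_cut]
    exact h w J (fun x hx => (hJ hx).1) hJf
  set J' := J ∪ {x | M w x} with hJ'
  have hJ'f : J'.Finite := hJf.union (Set.Subsingleton.finite fun x hx y hy => hM.ru hx hy)
  have hJ'L : J' ⊆ nb L w := by
    rintro x (hx | hx)
    · exact (hJ hx).1
    · exact (hM.sub hx).1.1
  obtain ⟨X, hX, N, hN⟩ := (h w J' hJ'L hJ'f).exists_isLink_swap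
  obtain ⟨N', hN'⟩ := Cov.repair (G := L) (G' := FlamePaper.cut L v T) (Mv := M) (A := J') (X := X)
    (Z := bdAt L B v (bub L B v)) (C := bub L B v) (v := v) (y := w) ⟨N, hN.toIsCov⟩
    (fun x w h hx => ⟨h, fun h => absurd h hx⟩) hwv (fun w h => nb_subset_bub L B v h)
    (hM.toIsCov.mono (fun x w _ h => ⟨⟨h.1.1, fun h' => absurd h' h.1.2.1⟩, h.2⟩)
      (fun w hw => ⟨hT hw, fun _ => hw⟩) subset_rfl)
    (fun x w h => (hM.sub h).1.2.1)
    (fun c hc hcv d hcd hd => mem_bdAt (mem_bub L B v) hc hcv (.inr ⟨d, hd, hcd⟩))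
    (fun c hcX hc hcv => mem_bdAt (mem_bub L B v) hc hcv (.inl (hX hcX).1))
    (fun x hx => .inr hx) (fun h => (hX h).2 rfl)
  obtain ⟨A', hA', N'', -, hN'', -⟩ := hN'.exists_isLink
  have : A' = J' := (hJ'f.subset hA').eq_of_subset_of_encard_le hA'
    (by rw [hN''.encard_eq, hN.encard_eq])
  subst this
  exact (hN''.cov_swap hX).mono (fun _ _ h => h) subset_rfl Set.subset_union_left

end Cutting

section Construction
open Relation

/-- `M` links `N` to a subset of `B`, and the vertices selected by `g` separate `v` from `B`
in `D`. -/
def GoodLink (D : V → V → Prop) (B : Set V) (v : V) (N : Set V) (M : V → V → Prop) : Prop :=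
  (∀ x y, M x y → x ≠ v ∧ y ≠ v) ∧
  ∃ X ⊆ B \ {v}, IsLink M N X M ∧ ∃ C : Set V, ∃ g : V → V, v ∈ C ∧ (∀ x, D v x → x ∈ C) ∧
    (∀ u ∈ C, u ≠ v → u ∉ g '' N → u ∉ B ∧ ∀ w, D u w → w ∈ C) ∧ ∀ t ∈ N, ReflTransGen M t (g t)

/-- The property maintained while thinning out a digraph. -/
def Admissible (D : V → V → Prop) (B : Set V) (L : V → V → Prop) : Prop :=
  Quasi L B ∧ (∀ y, nb D y ⊆ bub L B y) ∧ ∀ x, ¬ L x x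

theorem Admissible.exists_cut [Countable V] {D L : V → V → Prop} {B J : Set V} {v : V}
    (h : Admissible D B L) (hJ : J ⊆ nb L v) (hJf : J.Finite) :
    ∃ T M, J ⊆ T ∧ T ⊆ nb L v ∧ Admissible D B (cut L v T) ∧ GoodLink D B v T M ∧
      (∀ x y, M x y → L x y) ∧ ∀ x, {y | M x y}.Finite := by
  obtain ⟨T, hJT, hT, M₁, hM₁⟩ := h.1.exists_isLink_bub hJ hJf
  obtain ⟨X, hX, M₂, hM₂⟩ := exists_isLink_bdAt_bub L B v
  have hlink := hM₁.concat (G := fun x y => M₁ x y ∨ M₂ x y) (C := bub L B v) hM₂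
    (fun x y h => .inl h) (fun x y h => .inr h)
    (fun x y h => (hM₁.sub h).2)
    (fun x y h => ⟨fun hx => by_contra fun h' => (hM₂.sub h).2.1 ⟨hx, h'⟩,
      fun hx => by_contra fun h' => (hM₂.sub h).2.2 ⟨hx, h'⟩⟩)
    (hT.trans (nb_subset_bub L B v))
    (fun x hx hxC => mem_bdAt (mem_bub L B v) hxC (fun h => (hX hx).2 h) (.inl (hX hx).1))
  choose! g hg using fun t (ht : t ∈ T) => hM₁.fwd ht
  refine ⟨T, fun x y => M₁ x y ∨ M₂ x y, hJT, hT, ⟨h.1.cut hT hM₁, fun y =>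
    (h.2.1 y).trans (bub_subset_bub_cut hT hM₁ y), fun x hx => h.2.2 x hx.1⟩,
    ⟨?_, X, hX, hlink, bub L B v, g, mem_bub L B v, h.2.1 v, ?_, ?_⟩, ?_, ?_⟩
  · rintro x y (h | h)
    · exact ⟨(hM₁.sub h).1.2.1, (hM₁.sub h).1.2.2⟩
    · exact ⟨(hM₂.sub h).1.2.1, (hM₂.sub h).1.2.2⟩
  · intro u hu huv huY
    have huY : u ∉ bdAt L B v (bub L B v) := by
      intro hu'
      obtain ⟨t, ht, htu⟩ := hM₁.reach hu'
      exact huY ⟨t, ht, hM₁.target_unique (hg t ht).1 hu' (hg t ht).2 htu⟩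
    exact ⟨fun huB => huY (mem_bdAt (mem_bub L B v) hu huv (.inl huB)),
      fun w huw => bub_subset_bub hu huY (h.2.1 u huw)⟩
  · exact fun t ht => ReflTransGen.mono (fun _ _ h => .inl h) _ _ (hg t ht).2
  · rintro x y (h | h)
    · exact (hM₁.sub h).1.1
    · exact (hM₂.sub h).1.1
  · exact fun x => Set.Subsingleton.finite fun y hy z hz => hlink.ru hy hz

/-- A stage of the construction: the current digraph together with the edges already needed. -/
structure Stage (D : V → V → Prop) (B : Set V) where
  graph : V → V → Prop
  used : V → V → Prop
  le : graph ≤ D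
  admissible : Admissible D B graph
  used_le : used ≤ graph
  finite : ∀ x, {y | used x y}.Finite

theorem Stage.exists_next [Countable V] {D : V → V → Prop} {B : Set V} (s : Stage D B) (v : V) :
    ∃ s' : Stage D B, ∃ M T, GoodLink D B v T M ∧ T ⊆ nb s.graph v ∧ s'.graph = cut s.graph v T ∧
      s.used ≤ s'.used ∧ M ≤ s'.used := by
  obtain ⟨T, M, hJT, hT, hadm, hgood, hML, hMf⟩ :=
    s.admissible.exists_cut (v := v) (J := {w | s.used v w}) (fun w hw => s.used_le v w hw)
      (s.finite v)
  refine ⟨⟨cut s.graph v T, s.used ⊔ M, fun x y h => s.le x y h.1, hadm, ?_, ?_⟩, M, T, hgood,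
    hT, rfl, le_sup_left, le_sup_right⟩
  · rintro x y (h | h)
    · refine ⟨s.used_le x y h, ?_⟩
      rintro rfl
      exact hJT h
    · exact ⟨hML x y h, fun hx => absurd hx (hgood.1 x y h).1⟩
  · intro x
    exact (s.finite x).union (hMf x)

theorem exists_goodLink [Countable V] [Infinite V] (D : V → V → Prop) (hD : ∀ x, ¬ D x x)
    (B : Set V) : ∃ E ≤ D, ∀ v, ∃ M ≤ E, GoodLink D B v (nb E v) M := by
  obtain ⟨e⟩ := nonempty_equiv_of_countable (α := ℕ) (β := V)
  obtain ⟨Q, hQD, hQ, hQb⟩ := exists_quasi D hD B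
  let s₀ : Stage D B := ⟨Q, fun _ _ => False, hQD, ⟨hQ, hQb, fun x hx => hD x (hQD x x hx)⟩,
    fun _ _ h => h.elim, fun x => by simp⟩
  choose nx M T hgood hT hcut hused hM using fun (s : Stage D B) v => s.exists_next v
  let s : ℕ → Stage D B := fun n => Nat.rec s₀ (fun n s => nx s (e n)) n
  have hs : ∀ n, s (n + 1) = nx (s n) (e n) := fun n => rfl
  have hgr : ∀ n, (s (n + 1)).graph = cut (s n).graph (e n) (T (s n) (e n)) := fun n => hcut _ _
  have hanti : Antitone fun n => (s n).graph := antitone_nat_of_succ_le fun n => by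
    rw [hgr]
    exact fun x y h => h.1
  have hmono : Monotone fun n => (s n).used := monotone_nat_of_le_succ fun n => hused _ _
  refine ⟨fun x y => ∀ n, (s n).graph x y, fun x y h => s₀.le x y (h 0), fun v => ?_⟩
  obtain ⟨n, rfl⟩ := e.surjective v
  have hnb : nb (fun x y => ∀ n, (s n).graph x y) (e n) = T (s n) (e n) := by
    ext t
    constructor
    · intro h
      have := h (n + 1)
      rw [hgr] at this
      exact this.2 rfl
    · intro ht k
      have key : ∀ k, n + 1 ≤ k → (s k).graph (e n) t := by
        intro k hk
        induction k, hk using Nat.le_induction with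
        | base =>
          rw [hgr]
          exact ⟨hT _ _ ht, fun _ => ht⟩
        | succ k hk ih =>
          rw [hgr]
          exact ⟨ih, fun h => absurd (e.injective h) (by omega)⟩
      exact hanti (le_max_left k (n + 1)) _ _ (key _ (le_max_right k (n + 1)))
  refine ⟨M (s n) (e n), fun x y h k => ?_, ?_⟩
  · refine hanti (le_max_left k (n + 1)) _ _ ((s _).used_le _ _ ?_)
    exact hmono (le_max_right k (n + 1)) _ _ (hM _ _ _ _ h)
  · rw [hnb]
    exact hgood _ _

end Construction

section Conversion
open Relation

theorem edges_subset_of_isChain {S : Set (V × V)} {l : List V}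
    (h : l.IsChain fun a b => (a, b) ∈ S) : ∀ e ∈ l.zip l.tail, e ∈ S := by
  induction l with
  | nil => simp
  | cons a l ih =>
    cases l with
    | nil => simp
    | cons b l =>
      rw [List.isChain_cons_cons] at h
      intro e he
      rw [List.tail_cons, List.zip_cons_cons, List.mem_cons] at he
      rcases he with rfl | he
      · exact h.1
      · exact ih h.2 e he

theorem mem_zip_tail_append_pair {p : List V} {a t v : V} (hv : v ∉ p) (htv : t ≠ v) :
    (a, v) ∈ (p ++ [t, v]).zip (p ++ [t, v]).tail ↔ a = t := by
  induction p with
  | nil => simp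
  | cons b p ih =>
    simp only [List.mem_cons, not_or] at hv
    have ih := ih hv.2
    cases p with
    | nil => simp [Ne.symm htv]
    | cons c p =>
      simp only [List.cons_append, List.tail_cons, List.zip_cons_cons, List.mem_cons,
        Prod.mk.injEq] at ih ⊢
      rw [← ih]
      refine or_iff_right fun h => hv.2 (h.2 ▸ List.mem_cons_self)

theorem mem_of_reflTransGen {M : V → V → Prop} {l : List V} {a x z : V}
    (hM : ∀ ⦃x y z⦄, M x y → M x z → y = z) (hx : ∀ y, ¬ M x y) (hc : l.IsChain M)
    (ha : l.head? = some a) (hl : l.getLast? = some x) (h : ReflTransGen M a z) : z ∈ l := by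
  induction h with
  | refl => exact List.mem_of_mem_head? ha
  | tail h1 h2 ih =>
    rename_i b c
    obtain ⟨i, hi, rfl⟩ := List.getElem_of_mem ih
    by_cases hi' : i + 1 < l.length
    · rw [hM h2 (List.isChain_iff_getElem.1 hc i hi')]
      exact List.getElem_mem _
    · rw [List.getLast?_eq_getElem?, show l.length - 1 = i by omega,
        List.getElem?_eq_getElem hi] at hl
      exact absurd h2 (Option.some.inj hl ▸ hx c)

theorem reflTransGen_of_mem {M : V → V → Prop} {l : List V} {a z : V} (hc : l.IsChain M)
    (ha : l.head? = some a) (hz : z ∈ l) : ReflTransGen M a z := by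
  have key : ∀ i (hi : i < l.length), ReflTransGen M a l[i] := by
    intro i
    induction i with
    | zero =>
      intro hi
      rw [List.head?_eq_getElem?, List.getElem?_eq_getElem hi] at ha
      rw [Option.some.inj ha]
    | succ i ih => exact fun hi => (ih (by omega)).tail (List.isChain_iff_getElem.1 hc i hi)
  obtain ⟨i, hi, rfl⟩ := List.getElem_of_mem hz
  exact key i hi

/-- A path avoiding `Y` traced backwards from `v` cannot leave `C`. -/
theorem head_mem_of_avoids {D : Set (V × V)} {C Y : Set V} {r v : V} (hvr : v ≠ r)
    (hvC : v ∈ C) (hv : ∀ a, (a, v) ∈ D → a ≠ v → a ≠ r → a ∈ C)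
    (hC : ∀ u ∈ C, u ≠ v → u ∉ Y → (r, u) ∉ D ∧ ∀ w, (w, u) ∈ D → w ≠ u → w ≠ r → w ∈ C)
    (l : List V) : ∀ a, l.Nodup → (∀ e ∈ l.zip l.tail, e ∈ D ∧ e ≠ (r, v)) → l.head? = some a →
      l.getLast? = some v → (∀ x ∈ l, x ∉ Y) → a ∈ C ∧ a ≠ r := by
  induction l with
  | nil => simp
  | cons b l ih =>
    intro a hn he ha hl hY
    obtain rfl : b = a := by simpa using ha
    cases l with
    | nil =>
      obtain rfl : b = v := by simpa using hl
      exact ⟨hvC, hvr⟩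
    | cons c l =>
      rw [List.nodup_cons] at hn
      rw [List.tail_cons, List.zip_cons_cons] at he
      have hbc := he (b, c) (List.mem_cons_self)
      obtain ⟨hcC, hcr⟩ := ih c hn.2 (fun e h => he e (List.mem_cons_of_mem _ h)) rfl
        (by simpa [List.getLast?_cons_cons] using hl) (fun x hx => hY x (List.mem_cons_of_mem _ hx))
      have hne : b ≠ c := fun h => hn.1 (h ▸ List.mem_cons_self)
      by_cases hcv : c = v
      · subst hcv
        have hbr : b ≠ r := fun h => hbc.2 (by rw [h])
        exact ⟨hv b hbc.1 hne hbr, hbr⟩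
      · obtain ⟨h1, h2⟩ := hC c hcC hcv (hY c (by simp))
        have hbr : b ≠ r := fun h => h1 (h ▸ hbc.1)
        exact ⟨h2 b hbc.1 hne hbr, hbr⟩

/-- The path consisting of `r`, the reverse of a list and `v`. -/
theorem exists_diPath_of_isChain {S : Set (V × V)} {l : List V} {r v t x : V} (hn : l.Nodup)
    (hc : l.IsChain fun a b => (b, a) ∈ S) (ht : l.head? = some t) (hx : l.getLast? = some x)
    (hr : r ∉ l) (hv : v ∉ l) (hrv : v ≠ r) (htS : (t, v) ∈ S) (hxS : (r, x) ∈ S) :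
    ∃ P : DiPath V, IsPath S r v P ∧ P.lastEdge = {(t, v)} ∧
      P.vertexSet = insert r (insert v {z | z ∈ l}) := by
  obtain ⟨l, rfl⟩ : ∃ l', l = t :: l' := by
    cases l with
    | nil => simp at ht
    | cons a l => exact ⟨l, by simpa using ht⟩
  have hverts : r :: ((t :: l).reverse ++ [v]) = (r :: l.reverse) ++ [t, v] := by simp
  let P : DiPath V := ⟨r :: ((t :: l).reverse ++ [v]), List.cons_ne_nil _ _, by
    rw [List.nodup_cons, List.nodup_append, List.nodup_reverse]
    refine ⟨?_, hn, by simp, ?_⟩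
    · simp only [List.mem_append, List.mem_reverse, List.mem_singleton, not_or]
      exact ⟨hr, hrv.symm⟩
    · intro a ha b hb
      rw [List.mem_reverse] at ha
      rw [List.mem_singleton.1 hb]
      rintro rfl
      exact hv ha⟩
  have hlast : P.last = v := by
    simp [P, DiPath.last]
  have htv : t ≠ v := fun h => hv (h ▸ List.mem_cons_self)
  have hchain : P.verts.IsChain fun a b => (a, b) ∈ S := by
    change (r :: ((t :: l).reverse ++ [v])).IsChain _
    rw [List.isChain_cons, List.isChain_append, List.isChain_reverse]
    refine ⟨?_, hc, by simp, ?_⟩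
    · intro y hy
      rw [List.head?_append, List.head?_reverse, hx] at hy
      obtain rfl : x = y := by simpa using hy
      exact hxS
    · intro a ha b hb
      rw [List.getLast?_reverse, ht] at ha
      obtain rfl : t = a := by simpa using ha
      obtain rfl : v = b := by simpa using hb
      exact htS
  refine ⟨P, ⟨edges_subset_of_isChain hchain, rfl, hlast⟩, ?_, ?_⟩
  · have key := fun a => mem_zip_tail_append_pair (p := r :: l.reverse) (a := a) (v := v)
      (fun h => by
        rcases List.mem_cons.1 h with h | h
        · exact hrv h
        · exact hv (List.mem_cons_of_mem _ (List.mem_reverse.1 h))) htv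
    rw [← hverts] at key
    ext ⟨a, b⟩
    simp only [DiPath.lastEdge, hlast, Set.mem_ofPred_eq, Set.mem_singleton_iff, Prod.mk.injEq]
    constructor
    · rintro ⟨h, rfl⟩
      exact ⟨(key a).1 h, rfl⟩
    · rintro ⟨rfl, rfl⟩
      exact ⟨(key a).2 rfl, rfl⟩
  · ext z
    simp only [DiPath.vertexSet, P, Set.mem_ofPred_eq, List.mem_cons, List.mem_append,
      List.mem_reverse, Set.mem_insert_iff, List.not_mem_nil]
    tauto

/-- The path consisting of a single edge. -/
def edgePath (r v : V) (h : r ≠ v) : DiPath V := ⟨[r, v], by simp, by simpa using h⟩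

theorem edgePath_edges {r v : V} (h : r ≠ v) : (edgePath r v h).edges = {(r, v)} := by
  ext
  simp [edgePath, DiPath.edges]

theorem edgePath_lastEdge {r v : V} (h : r ≠ v) : (edgePath r v h).lastEdge = {(r, v)} := by
  ext e
  rw [DiPath.lastEdge, edgePath_edges]
  simp only [Set.mem_ofPred_eq, Set.mem_singleton_iff, and_iff_left_iff_imp]
  rintro rfl
  rfl

theorem edgePath_vertexSet {r v : V} (h : r ≠ v) : (edgePath r v h).vertexSet = {r, v} := by
  ext
  simp [edgePath, DiPath.vertexSet]

/-- Good linkages give systems of internally disjoint paths. -/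
theorem exists_system_of_goodLink {D S : Set (V × V)} {N : Set V} {M : V → V → Prop} {r v : V}
    (hvr : v ≠ r) (hD : ∀ a, (a, r) ∉ D) (hSD : S ⊆ D) (hrS : ∀ b, (r, b) ∈ D → (r, b) ∈ S)
    (hM : GoodLink (fun x y => (y, x) ∈ D ∧ x ≠ y ∧ x ≠ r ∧ y ≠ r) {b | (r, b) ∈ D} v N M)
    (hMS : ∀ x y, M x y → (y, x) ∈ S ∧ y ≠ r) (hNS : ∀ t ∈ N, (t, v) ∈ S)
    (hN : ∀ t ∈ N, t ≠ v ∧ t ≠ r)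
    (hSN : ∀ t, (t, v) ∈ S → t ≠ r → t ∈ N) :
    ∃ Ps, EMSystem D r v Ps ∧ IntDisjSystem S r v Ps ∧ lastEdges Ps = inEdges S v := by
  classical
  obtain ⟨hMv, X, hX, hlink, C, g, hvC, hDC, hC, hg⟩ := hM
  have hpath : ∀ t : N, ∃ P : DiPath V, IsPath S r v P ∧ P.lastEdge = {((t : V), v)} ∧
      P.vertexSet = insert r (insert v {z | ReflTransGen M t z}) := by
    rintro ⟨t, ht⟩
    obtain ⟨x, hx, htx⟩ := hlink.fwd ht
    obtain ⟨l, hn, hc, hh, hl⟩ := exists_nodup_isChain htx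
    have hmem : ∀ z, z ∈ l ↔ ReflTransGen M t z := fun z =>
      ⟨reflTransGen_of_mem hc hh, mem_of_reflTransGen hlink.ru (fun _ => hlink.out hx) hc hh hl⟩
    have havoid : ∀ z ∈ l, z ≠ v ∧ z ≠ r := by
      intro z hz
      rcases ((hmem z).1 hz).cases_tail with rfl | ⟨y, -, hy⟩
      · exact hN _ ht
      · exact ⟨(hMv _ _ hy).2, (hMS _ _ hy).2⟩
    obtain ⟨P, h1, h2, h3⟩ := exists_diPath_of_isChain (S := S) (r := r) (v := v) hn
      (hc.imp fun a b h => (hMS a b h).1) hh hl (fun h => (havoid r h).2 rfl)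
      (fun h => (havoid v h).1 rfl) hvr (hNS t ht) (hrS x (hX hx).1)
    refine ⟨P, h1, h2, ?_⟩
    simp only [h3, hmem]
  choose p hpS hpl hpv using hpath
  have hav : ∀ (t : N) z, ReflTransGen M t z → z ≠ v ∧ z ≠ r := by
    rintro ⟨t, ht⟩ z hz
    rcases hz.cases_tail with rfl | ⟨y, -, hy⟩
    · exact hN _ ht
    · exact ⟨(hMv _ _ hy).2, (hMS _ _ hy).2⟩
  set P₀ := edgePath r v hvr.symm with hP₀
  have hpP₀ : ∀ t, p t ≠ P₀ := by
    intro t h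
    have : (t : V) ∈ (p t).vertexSet := by
      rw [hpv]
      exact .inr (.inr .refl)
    rw [h, hP₀, edgePath_vertexSet] at this
    rcases this with h | h
    · exact (hN _ t.2).2 h
    · exact (hN _ t.2).1 h
  have hinter : ∀ t t' : N, t ≠ t' → (p t).vertexSet ∩ (p t').vertexSet = {r, v} := by
    intro t t' htt
    ext z
    rw [hpv, hpv]
    constructor
    · rintro ⟨h | h | h, h' | h' | h'⟩
      iterate 8 first | exact .inl h | exact .inr h | exact .inl h' | exact .inr h'
      exact absurd (Subtype.ext (hlink.source_unique t.2 t'.2 h h')) htt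
    · rintro (h | h)
      · exact ⟨.inl h, .inl h⟩
      · exact ⟨.inr (.inl h), .inr (.inl h)⟩
  have hinj : Function.Injective p := by
    intro t t' h
    by_contra htt
    have h1 : (t : V) ∈ (p t).vertexSet ∩ (p t').vertexSet := by
      rw [← h, Set.inter_self, hpv]
      exact .inr (.inr .refl)
    rw [hinter t t' htt] at h1
    rcases h1 with h | h
    · exact (hN _ t.2).2 h
    · exact (hN _ t.2).1 h
  set Ps : Set (DiPath V) := {P | ((r, v) ∈ D ∧ P = P₀) ∨ ∃ t, P = p t} with hPs
  have hsub : ∀ t, (p t).vertexSet ∩ P₀.vertexSet = {r, v} := by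
    intro t
    rw [hP₀, edgePath_vertexSet, Set.inter_eq_right, hpv]
    rintro z (h | h)
    · exact .inl h
    · exact .inr (.inl h)
  have hsys : IntDisjSystem S r v Ps := by
    constructor
    · rintro P (⟨h, rfl⟩ | ⟨t, rfl⟩)
      · refine ⟨?_, rfl, rfl⟩
        rw [IsPathIn, hP₀, edgePath_edges, Set.singleton_subset_iff]
        exact hrS v h
      · exact hpS t
    · rintro P (⟨h, rfl⟩ | ⟨t, rfl⟩) Q (⟨h', rfl⟩ | ⟨t', rfl⟩) hne
      · exact absurd rfl hne
      · rw [Set.inter_comm]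
        exact hsub t'
      · exact hsub t
      · exact hinter t t' fun h => hne (h ▸ rfl)
  refine ⟨Ps, ⟨⟨fun P hP => ⟨(hsys.1 P hP).1.trans hSD, (hsys.1 P hP).2⟩, hsys.2⟩, ?_⟩, hsys, ?_⟩
  · let sel : DiPath V → V ⊕ (V × V) := fun P =>
      if h : ∃ t, p t = P then Sum.inl (g h.choose) else Sum.inr (r, v)
    have hsel : ∀ t, sel (p t) = Sum.inl (g t) := by
      intro t
      have h : ∃ t', p t' = p t := ⟨t, rfl⟩
      simp only [sel, dif_pos h, hinj h.choose_spec]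
    have hsel₀ : sel P₀ = Sum.inr (r, v) := by
      have h : ¬ ∃ t', p t' = P₀ := fun ⟨t, ht⟩ => hpP₀ t ht
      simp only [sel, dif_neg h]
    refine ⟨sel, ?_, ?_⟩
    · rintro P (⟨h, rfl⟩ | ⟨t, rfl⟩)
      · rw [hsel₀]
        refine ⟨fun x h => by simp at h, fun e h => ?_⟩
        rw [← Sum.inr.inj h, hP₀, edgePath_edges]
        rfl
      · rw [hsel]
        refine ⟨fun x h => ?_, fun e h => by simp at h⟩
        rw [← Sum.inl.inj h, DiPath.internal, (hpS t).2.1, (hpS t).2.2, hpv]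
        refine ⟨.inr (.inr (hg t t.2)), ?_⟩
        rintro (h | h)
        · exact (hav t _ (hg t t.2)).2 h
        · exact (hav t _ (hg t t.2)).1 h
    · intro Q hQ
      by_cases hrv : (r, v) ∈ Q.edges
      · refine ⟨P₀, .inl ⟨hQ.1 hrv, rfl⟩, ?_⟩
        rw [hsel₀]
        exact ⟨fun x h => by simp at h, fun e h => Sum.inr.inj h ▸ hrv⟩
      · by_contra hno
        refine (head_mem_of_avoids (D := D) (C := C) (Y := g '' N) hvr hvC
          (fun a ha hav har => hDC a ⟨ha, hav.symm, hvr, har⟩) ?_ Q.verts r Q.nodup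
          (fun e he => ⟨hQ.1 he, fun h => hrv (h ▸ he)⟩) ?_ ?_ ?_).2 rfl
        · intro u hu huv huY
          refine ⟨(hC u hu huv huY).1, fun w hw hwu hwr => (hC u hu huv huY).2 w
            ⟨hw, hwu.symm, ?_, hwr⟩⟩
          rintro rfl
          exact hD _ hw
        · rw [List.head?_eq_some_head Q.ne]
          exact congrArg some hQ.2.1
        · rw [List.getLast?_eq_some_getLast Q.ne]
          exact congrArg some hQ.2.2
        · rintro _ hx ⟨t, ht, rfl⟩
          refine hno ⟨p ⟨t, ht⟩, .inr ⟨_, rfl⟩, ?_⟩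
          rw [hsel]
          exact ⟨fun x h => Sum.inl.inj h ▸ hx, fun e h => by simp at h⟩
  · ext ⟨a, b⟩
    simp only [lastEdges, Set.mem_iUnion, inEdges, Set.mem_ofPred_eq, exists_prop]
    constructor
    · rintro ⟨P, ⟨h, rfl⟩ | ⟨t, rfl⟩, hP⟩
      · rw [hP₀, edgePath_lastEdge] at hP
        cases hP
        exact ⟨hrS v h, rfl⟩
      · rw [hpl] at hP
        cases hP
        exact ⟨hNS t t.2, rfl⟩
    · rintro ⟨h, rfl⟩
      by_cases har : a = r
      · subst har
        exact ⟨P₀, .inl ⟨hSD h, rfl⟩, by rw [hP₀, edgePath_lastEdge]; rfl⟩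
      · exact ⟨p ⟨a, hSN a h har⟩, .inr ⟨_, rfl⟩, by rw [hpl]; rfl⟩

end Conversion

/-- Main theorem: every countable rooted digraph `D` has a `D`-vertex-large spanning
subdigraph which is a vertex-flame. -/
theorem main_flame {V : Type} [Infinite V] [Countable V] (r : V)
    (D : Set (V × V)) (hroot : IsRooted D r) :
    ∃ E, IsLarge D E r ∧ IsFlame E r := by
  have hD : ∀ a, (a, r) ∉ D := fun a h => by
    have : (a, r) ∈ inEdges D r := ⟨h, rfl⟩
    rw [hroot] at this
    exact this
  obtain ⟨E, hED, hE⟩ := exists_goodLink (fun x y => (y, x) ∈ D ∧ x ≠ y ∧ x ≠ r ∧ y ≠ r)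
    (fun x h => h.2.1 rfl) {b | (r, b) ∈ D}
  set S : Set (V × V) := {e | (e.1 = r ∧ e ∈ D) ∨ E e.2 e.1} with hS
  have hSD : S ⊆ D := by
    rintro e (h | h)
    · exact h.2
    · exact (hED _ _ h).1
  have key : ∀ v, v ≠ r → ∃ Ps, EMSystem D r v Ps ∧ IntDisjSystem S r v Ps ∧
      lastEdges Ps = inEdges S v := by
    intro v hv
    obtain ⟨M, hME, hM⟩ := hE v
    exact exists_system_of_goodLink hv hD hSD (fun b hb => .inl ⟨rfl, hb⟩) hM
      (fun x y h => ⟨.inr (hME _ _ h), (hED _ _ (hME _ _ h)).2.2.2⟩) (fun t ht => .inr ht)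
      (fun t ht => ⟨(hED _ _ ht).2.1.symm, (hED _ _ ht).2.2.2⟩)
      (fun t ht htr => ht.resolve_left fun h => htr h.1)
  refine ⟨S, ⟨hSD, fun v hv => ?_⟩, fun v hv => ?_⟩
  · obtain ⟨Ps, h1, h2, -⟩ := key v hv
    exact ⟨Ps, h1, fun P hP => (h2.1 P hP).1⟩
  · obtain ⟨Ps, -, h2, h3⟩ := key v hv
    exact ⟨Ps, h2, h3⟩

end FlamePaper
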